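/- arXiv:2512.24996 — 2 statements merged into one kernel-verified Lean document; each statement's English description precedes it below -/
import Mathlib

section
/- Let n ≥ 1 and let G be a closed subgroup of GL(n, ℝ) (with the topology inherited from the n×n real matrices) which contains a subgroup that is discrete in the subspace topology and isomorphic as a group to the free group on two generators. Let D_tf(G) be the set of torsion-free discrete subgroups of G, regarded as a subset of F(G) (discrete subgroups of the Hausdorff group G are closed) with the Borel structure inherited from the Fell topology on F(G), and let E(G, D_tf(G)) be the conjugacy relation on D_tf(G): Γ related to Γ' iff there is g ∈ G with gΓg⁻¹ = Γ'. Then E(G, D_tf(G)) is essentially countable universal: (i) E(G, D_tf(G)) is Borel reducible to some countable Borel equivalence relation on a standard Borel space; and (ii) every countable Borel equivalence relation on a standard Borel space is Borel reducible to E(G, D_tf(G)). -/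
open TopologicalSpace

universe u

/-- The Fell topology on the space `F(G)` of closed subsets of `G`, generated by the
subbasic open sets `{F : F ∩ K = ∅}` for `K` compact and `{F : F ∩ U ≠ ∅}` for `U`
open. -/
def fellTopology (X : Type*) [TopologicalSpace X] : TopologicalSpace (Closeds X) :=
  TopologicalSpace.generateFrom
    ({S | ∃ K : Set X, IsCompact K ∧ S = {F : Closeds X | (F : Set X) ∩ K = ∅}} ∪
      {S | ∃ U : Set X, IsOpen U ∧ S = {F : Closeds X | ((F : Set X) ∩ U).Nonempty}})

/-- The Borel σ-algebra of the Fell topology on `F(G)`. -/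
def fellBorel (X : Type*) [TopologicalSpace X] : MeasurableSpace (Closeds X) :=
  @borel _ (fellTopology X)

/-- A countable Borel equivalence relation on a standard Borel space. -/
structure CountableBorelER : Type (u + 1) where
  carrier : Type u
  inst : MeasurableSpace carrier
  standardBorel : @StandardBorelSpace carrier inst
  rel : carrier → carrier → Prop
  isEquivalence : Equivalence rel
  measurableSet_rel : @MeasurableSet (carrier × carrier) (inst.prod inst) {p | rel p.1 p.2}
  countable_classes : ∀ z, {w | rel z w}.Countable

attribute [instance] CountableBorelER.inst

/-- `E` is Borel reducible to `F`. -/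
def BorelReducible {X Y : Type*} [MeasurableSpace X] [MeasurableSpace Y]
    (E : X → X → Prop) (F : Y → Y → Prop) : Prop :=
  ∃ f : X → Y, Measurable f ∧ ∀ a b : X, E a b ↔ F (f a) (f b)

/-- The set `D_tf(G)` of torsion-free discrete subgroups of `G`, regarded as elements of
`F(G)` (discrete subgroups of the Hausdorff group `G` are closed). -/
abbrev TorsionFreeDiscreteCode {n : ℕ} (G : Subgroup (Matrix (Fin n) (Fin n) ℝ)ˣ) :
    Type :=
  {F : Closeds G // ∃ Γ : Subgroup ↥G, DiscreteTopology Γ ∧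
    (∀ g ∈ Γ, g ≠ 1 → ¬IsOfFinOrder g) ∧ (F : Set ↥G) = ↑Γ}

/-- The Borel structure on `D_tf(G)` inherited from the Fell topology on `F(G)`. -/
def torsionFreeDiscreteBorel {n : ℕ} (G : Subgroup (Matrix (Fin n) (Fin n) ℝ)ˣ) :
    MeasurableSpace (TorsionFreeDiscreteCode G) :=
  (fellBorel ↥G).comap Subtype.val

/-- The conjugacy relation `E(G, D_tf(G))`: `Γ` is related to `Γ'` iff `gΓg⁻¹ = Γ'` for
some `g ∈ G`. -/
def conjugacyRel {n : ℕ} (G : Subgroup (Matrix (Fin n) (Fin n) ℝ)ˣ) :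
    TorsionFreeDiscreteCode G → TorsionFreeDiscreteCode G → Prop :=
  fun F₁ F₂ => ∃ g : ↥G, (fun a => g * a * g⁻¹) '' (F₁.1 : Set ↥G) = (F₂.1 : Set ↥G)

section

open TopologicalSpace Set Topology MeasureTheory
open scoped Pointwise

/-- The space of closed subsets of `X`, carrying the Fell topology. -/
def FellSpace (X : Type*) [TopologicalSpace X] : Type _ := Closeds X

namespace FellSpace

variable {X : Type*} [TopologicalSpace X]

instance : TopologicalSpace (FellSpace X) := fellTopology X

instance : MeasurableSpace (FellSpace X) := fellBorel X

instance : BorelSpace (FellSpace X) := ⟨rfl⟩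

instance : SetLike (FellSpace X) X := inferInstanceAs (SetLike (Closeds X) X)

/-- The closed sets disjoint from `K`. -/
def miss (K : Set X) : Set (FellSpace X) := {F | (F : Set X) ∩ K = ∅}

/-- The closed sets meeting `U`. -/
def hit (U : Set X) : Set (FellSpace X) := {F | ((F : Set X) ∩ U).Nonempty}

theorem isClosed (F : FellSpace X) : IsClosed (F : Set X) := Closeds.isClosed F

theorem isOpen_miss {K : Set X} (hK : IsCompact K) : IsOpen (miss K) :=
  isOpen_generateFrom_of_mem (Or.inl ⟨K, hK, rfl⟩)

theorem isOpen_hit {U : Set X} (hU : IsOpen U) : IsOpen (hit U) :=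
  isOpen_generateFrom_of_mem (Or.inr ⟨U, hU, rfl⟩)

theorem mem_hit {U : Set X} {F : FellSpace X} : F ∈ hit U ↔ ∃ x ∈ F, x ∈ U := Iff.rfl

theorem mem_miss {K : Set X} {F : FellSpace X} : F ∈ miss K ↔ ∀ x ∈ F, x ∉ K := by
  simp only [miss, mem_ofPred_eq, Set.eq_empty_iff_forall_notMem, mem_inter_iff, not_and]
  rfl

theorem continuous_of {Y : Type*} [TopologicalSpace Y] {f : Y → FellSpace X}
    (h₁ : ∀ K, IsCompact K → IsOpen (f ⁻¹' miss K)) (h₂ : ∀ U, IsOpen U → IsOpen (f ⁻¹' hit U)) :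
    Continuous f := by
  refine continuous_generateFrom_iff.2 ?_
  rintro _ (⟨K, hK, rfl⟩ | ⟨U, hU, rfl⟩)
  exacts [h₁ K hK, h₂ U hU]

instance : CompactSpace (FellSpace X) := by
  refine compactSpace_generateFrom (T := fellTopology X) rfl fun P hP hcov => ?_
  let 𝒰 : Set (Set X) := {U | IsOpen U ∧ hit U ∈ P}
  have hopen : IsOpen (⋃₀ 𝒰) := isOpen_sUnion fun U hU => hU.1
  let F₀ : FellSpace X := (⟨(⋃₀ 𝒰)ᶜ, hopen.isClosed_compl⟩ : Closeds X)
  obtain ⟨S, hSP, hS⟩ : F₀ ∈ ⋃₀ P := hcov ▸ mem_univ _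
  rcases hP hSP with ⟨K, hK, rfl⟩ | ⟨U, hU, rfl⟩
  · have hKU : K ⊆ ⋃₀ 𝒰 := by
      intro x hx
      by_contra hxU
      exact mem_miss.1 hS x hxU hx
    obtain ⟨t, ht⟩ := hK.elim_finite_subcover (fun U : 𝒰 => (U : Set X)) (fun U => U.2.1)
      (by rwa [← sUnion_eq_iUnion])
    refine ⟨insert (miss K) ((fun U : 𝒰 => hit (U : Set X)) '' t), ?_,
      (t.finite_toSet.image _).insert _, eq_univ_of_forall fun F => ?_⟩
    · rintro _ (rfl | ⟨U, -, rfl⟩)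
      exacts [hSP, U.2.2]
    · by_cases hF : F ∈ miss K
      · exact mem_sUnion_of_mem hF (mem_insert _ _)
      · obtain ⟨x, hx, hxK⟩ : ∃ x ∈ F, x ∈ K := by
          by_contra! h
          exact hF (mem_miss.2 h)
        obtain ⟨U, hU, hxU⟩ := mem_iUnion₂.1 (ht hxK)
        exact mem_sUnion_of_mem (mem_hit.2 ⟨x, hx, hxU⟩) (Or.inr ⟨U, hU, rfl⟩)
  · obtain ⟨x, hx, hxU⟩ := mem_hit.1 hS
    exact absurd (show x ∈ ⋃₀ 𝒰 from ⟨U, ⟨hU, hSP⟩, hxU⟩) hx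

instance [T2Space X] [LocallyCompactSpace X] : T2Space (FellSpace X) := by
  have key : ∀ F F' : FellSpace X, ∀ x ∈ F, x ∉ F' →
      ∃ u v : Set (FellSpace X), IsOpen u ∧ IsOpen v ∧ F ∈ u ∧ F' ∈ v ∧ Disjoint u v := by
    intro F F' x hx hx'
    obtain ⟨K, hK, hKx, hKF⟩ := local_compact_nhds (F'.isClosed.isOpen_compl.mem_nhds hx')
    refine ⟨hit (interior K), miss K, isOpen_hit isOpen_interior, isOpen_miss hKF, ?_, ?_, ?_⟩
    · exact ⟨x, hx, mem_interior_iff_mem_nhds.2 hK⟩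
    · exact mem_miss.2 fun y hy hyK => hKx hyK hy
    · refine Set.disjoint_left.2 fun A hA hA' => ?_
      obtain ⟨y, hy, hyK⟩ := hA
      exact mem_miss.1 hA' y hy (interior_subset hyK)
  refine ⟨fun F F' hne => ?_⟩
  have : ∃ x, ¬ (x ∈ F ↔ x ∈ F') := by
    by_contra h
    push Not at h
    exact hne (SetLike.ext h)
  obtain ⟨x, hx⟩ := this
  by_cases hxF : x ∈ F
  · exact key F F' x hxF (by tauto)
  · obtain ⟨u, v, hu, hv, h₁, h₂, h₃⟩ := key F' F x (by tauto) hxF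
    exact ⟨v, u, hv, hu, h₂, h₁, h₃.symm⟩

theorem eq_generateFrom [T2Space X] [LocallyCompactSpace X] [SecondCountableTopology X] :
    (inferInstance : TopologicalSpace (FellSpace X)) =
      generateFrom ((hit '' countableBasis X) ∪
        ((fun b => miss (closure b)) '' {b ∈ countableBasis X | IsCompact (closure b)})) := by
  refine le_antisymm (le_generateFrom ?_) (le_generateFrom ?_)
  · rintro _ (⟨b, hb, rfl⟩ | ⟨b, ⟨hb, hc⟩, rfl⟩)
    · exact isOpen_hit (isOpen_of_mem_countableBasis hb)
    · exact isOpen_miss hc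
  · let T : TopologicalSpace (FellSpace X) := generateFrom ((hit '' countableBasis X) ∪
        ((fun b => miss (closure b)) '' {b ∈ countableBasis X | IsCompact (closure b)}))
    rintro _ (⟨K, hK, rfl⟩ | ⟨U, hU, rfl⟩)
    · refine isOpen_iff_forall_mem_open.2 fun F hF => ?_
      have : ∀ x ∈ K, ∃ b ∈ countableBasis X, IsCompact (closure b) ∧ x ∈ b ∧
          F ∈ miss (closure b) := by
        intro x hx
        have hxF : x ∉ F := fun h => mem_miss.1 hF x h hx
        obtain ⟨L, hL, hLF, hLc⟩ := local_compact_nhds (F.isClosed.isOpen_compl.mem_nhds hxF)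
        obtain ⟨b, hb, hxb, hbL⟩ := (isBasis_countableBasis X).mem_nhds_iff.1 hL
        have hcl : closure b ⊆ L := closure_minimal hbL hLc.isClosed
        exact ⟨b, hb, hLc.of_isClosed_subset isClosed_closure hcl, hxb,
          mem_miss.2 fun y hy hyb => hLF (hcl hyb) hy⟩
      choose! b hb hbc hxb hbF using this
      obtain ⟨t, htK, hKt⟩ := hK.elim_nhds_subcover b fun x hx =>
        (isOpen_of_mem_countableBasis (hb x hx)).mem_nhds (hxb x hx)
      refine ⟨⋂ x ∈ t, miss (closure (b x)), fun A hA => mem_miss.2 fun y hy hyK => ?_,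
        isOpen_biInter_finset fun x hx => ?_, mem_iInter₂.2 fun x hx => hbF x (htK x hx)⟩
      · obtain ⟨x, hx, hyb⟩ := mem_iUnion₂.1 (hKt hyK)
        exact mem_miss.1 (mem_iInter₂.1 hA x hx) y hy (subset_closure hyb)
      · exact isOpen_generateFrom_of_mem (Or.inr ⟨b x, ⟨hb x (htK x hx), hbc x (htK x hx)⟩, rfl⟩)
    · refine isOpen_iff_forall_mem_open.2 fun F hF => ?_
      obtain ⟨x, hx, hxU⟩ := hF
      obtain ⟨b, hb, hxb, hbU⟩ := (isBasis_countableBasis X).mem_nhds_iff.1 (hU.mem_nhds hxU)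
      exact ⟨hit b, fun A ⟨y, hy, hyb⟩ => ⟨y, hy, hbU hyb⟩,
        isOpen_generateFrom_of_mem (Or.inl ⟨b, hb, rfl⟩), ⟨x, hx, hxb⟩⟩

instance [T2Space X] [LocallyCompactSpace X] [SecondCountableTopology X] :
    SecondCountableTopology (FellSpace X) :=
  ⟨⟨_, ((countable_countableBasis X).image _).union
    (((countable_countableBasis X).mono (sep_subset _ _)).image _), eq_generateFrom⟩⟩

instance [T2Space X] [LocallyCompactSpace X] [SecondCountableTopology X] :
    PolishSpace (FellSpace X) := by
  let := metrizableSpaceMetric (FellSpace X)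
  infer_instance

theorem measurable_of [T2Space X] [LocallyCompactSpace X] [SecondCountableTopology X]
    {Y : Type*} [MeasurableSpace Y] {f : Y → FellSpace X}
    (h₁ : ∀ K, IsCompact K → MeasurableSet (f ⁻¹' miss K))
    (h₂ : ∀ U, IsOpen U → MeasurableSet (f ⁻¹' hit U)) : Measurable f := by
  have h : fellBorel X = MeasurableSpace.generateFrom _ :=
    borel_eq_generateFrom_of_subbasis (α := FellSpace X) (t := fellTopology X) rfl
  change @Measurable _ _ _ (fellBorel X) f
  rw [h]
  refine measurable_generateFrom ?_
  rintro _ (⟨K, hK, rfl⟩ | ⟨U, hU, rfl⟩)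
  exacts [h₁ K hK, h₂ U hU]

end FellSpace

namespace FellSpace

variable {G : Type*} [Group G] [TopologicalSpace G] [IsTopologicalGroup G]

/-- The conjugation action on closed subsets of a topological group. -/
instance : MulAction G (FellSpace G) where
  smul g F := (⟨{x | g⁻¹ * x * g ∈ F}, F.isClosed.preimage (by fun_prop)⟩ : Closeds G)
  one_smul F := SetLike.ext fun x => by
    change 1⁻¹ * x * 1 ∈ F ↔ x ∈ F
    simp
  mul_smul g h F := SetLike.ext fun x => by
    change (g * h)⁻¹ * x * (g * h) ∈ F ↔ h⁻¹ * (g⁻¹ * x * g) * h ∈ F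
    simp only [mul_inv_rev, mul_assoc]

theorem coe_smul (g : G) (F : FellSpace G) :
    ((g • F : FellSpace G) : Set G) = (fun a => g * a * g⁻¹) '' (F : Set G) := by
  ext x
  constructor
  · intro hx
    exact ⟨_, hx, by group⟩
  · rintro ⟨a, ha, rfl⟩
    change g⁻¹ * (g * a * g⁻¹) * g ∈ F
    rwa [show g⁻¹ * (g * a * g⁻¹) * g = a by group]

theorem smul_eq_iff (g : G) (A B : FellSpace G) :
    g • A = B ↔ (fun a => g * a * g⁻¹) '' (A : Set G) = B := by
  rw [← coe_smul, SetLike.coe_set_eq]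

instance [LocallyCompactSpace G] : ContinuousSMul G (FellSpace G) := by
  refine ⟨continuous_of (fun K hK => ?_) fun U hU => ?_⟩
  · refine isOpen_iff_mem_nhds.2 ?_
    rintro ⟨g₀, F₀⟩ h₀
    have hopen : IsOpen {p : G × G | p.1⁻¹ * p.2 * p.1 ∉ F₀} :=
      F₀.isClosed.isOpen_compl.preimage (f := fun p : G × G => p.1⁻¹ * p.2 * p.1) (by fun_prop)
    obtain ⟨V, W, hV, -, hgV, hKW, hVW⟩ := generalized_tube_lemma (isCompact_singleton (x := g₀))
      hK hopen (by
        rintro ⟨g, k⟩ ⟨rfl, hk⟩ hmem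
        exact mem_miss.1 h₀ k hmem hk)
    obtain ⟨N, hN, hNV, hNc⟩ := local_compact_nhds (hV.mem_nhds (hgV rfl))
    have hL : IsCompact ((fun p : G × G => p.1⁻¹ * p.2 * p.1) '' (N ×ˢ K)) :=
      (hNc.prod hK).image (by fun_prop)
    have hF₀ : F₀ ∈ miss ((fun p : G × G => p.1⁻¹ * p.2 * p.1) '' (N ×ˢ K)) := by
      refine mem_miss.2 ?_
      rintro _ hx ⟨⟨g, k⟩, ⟨hg, hk⟩, rfl⟩
      exact hVW (mk_mem_prod (hNV hg) (hKW hk)) hx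
    refine Filter.mem_of_superset (prod_mem_nhds hN ((isOpen_miss hL).mem_nhds hF₀)) ?_
    rintro ⟨g, F⟩ ⟨hg, hF⟩
    exact mem_miss.2 fun x hx hxK => mem_miss.1 hF _ hx ⟨(g, x), ⟨hg, hxK⟩, rfl⟩
  · refine isOpen_iff_mem_nhds.2 ?_
    rintro ⟨g₀, F₀⟩ ⟨x, hx, hxU⟩
    have hopen : IsOpen {p : G × G | p.1 * p.2 * p.1⁻¹ ∈ U} :=
      hU.preimage (f := fun p : G × G => p.1 * p.2 * p.1⁻¹) (by fun_prop)
    obtain ⟨V, W, hV, hW, hgV, hxW, hVW⟩ := isOpen_prod_iff.1 hopen g₀ (g₀⁻¹ * x * g₀)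
      (by simpa [mul_assoc] using hxU)
    refine Filter.mem_of_superset (prod_mem_nhds (hV.mem_nhds hgV)
      ((isOpen_hit hW).mem_nhds ⟨_, hx, hxW⟩)) ?_
    rintro ⟨g, F⟩ ⟨hg, y, hy, hyW⟩
    refine ⟨g * y * g⁻¹, ?_, hVW (mk_mem_prod hg hyW)⟩
    change g⁻¹ * (g * y * g⁻¹) * g ∈ F
    rwa [show g⁻¹ * (g * y * g⁻¹) * g = y by group]

end FellSpace

section Selection

/-- The Kuratowski–Ryll-Nardzewski selection theorem, with a selector that does not depend on the
set-valued map. -/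
theorem exists_measurable_selector (P : Type*) [TopologicalSpace P] [PolishSpace P] [Nonempty P]
    [MeasurableSpace P] [BorelSpace P] :
    ∃ s : Set P → P, (∀ F, IsClosed F → F.Nonempty → s F ∈ F) ∧
      ∀ {Y : Type*} [MeasurableSpace Y] (Φ : Y → Set P),
        (∀ O, IsOpen O → MeasurableSet {y | (Φ y ∩ O).Nonempty}) →
          Measurable fun y => s (Φ y) := by
  let := upgradeIsCompletelyMetrizable P
  let d := denseSeq P
  have hd : DenseRange d := denseRange_denseSeq P
  let O : List ℕ → Set P := fun l =>
    l.rec univ fun n l o => o ∩ Metric.ball (d n) ((1 / 2) ^ l.length)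
  have hO : ∀ l, IsOpen (O l) := fun l => by
    induction l with
    | nil => exact isOpen_univ
    | cons n l ih => exact ih.inter Metric.isOpen_ball
  let next : Set P → List ℕ → ℕ := fun F l => sInf {n | (F ∩ O (n :: l)).Nonempty}
  obtain ⟨st, hst₀, hst⟩ : ∃ st : Set P → ℕ → List ℕ, (∀ F, st F 0 = []) ∧
      ∀ F k, st F (k + 1) = next F (st F k) :: st F k :=
    ⟨fun F k => k.rec [] fun _ l => next F l :: l, fun _ => rfl, fun _ _ => rfl⟩
  have hlen : ∀ F k, (st F k).length = k := fun F k => by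
    induction k with
    | zero => rw [hst₀]; rfl
    | succ k ih => rw [hst, List.length_cons, ih]
  let c : Set P → ℕ → P := fun F k => d (next F (st F k))
  have hne : ∀ F : Set P, F.Nonempty → ∀ k, (F ∩ O (st F k)).Nonempty := by
    intro F hF k
    induction k with
    | zero => simpa [hst₀, O] using hF
    | succ k ih =>
      obtain ⟨x, hxF, hxO⟩ := ih
      obtain ⟨n, hn⟩ := hd.exists_dist_lt x (show (0 : ℝ) < (1 / 2) ^ (st F k).length by positivity)
      rw [hst]
      exact Nat.sInf_mem (s := {n | (F ∩ O (n :: st F k)).Nonempty})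
        ⟨n, x, hxF, hxO, hn⟩
  have hpt : ∀ F : Set P, F.Nonempty → ∀ k, ∃ y ∈ F, dist y (c F k) < (1 / 2) ^ k ∧
      dist y (c F (k + 1)) < (1 / 2) ^ (k + 1) := by
    intro F hF k
    obtain ⟨y, hyF, hy⟩ := hne F hF (k + 2)
    rw [hst] at hy
    obtain ⟨hy, h₂⟩ := hy
    rw [hst] at hy
    obtain ⟨-, h₁⟩ := hy
    rw [hlen] at h₁ h₂
    exact ⟨y, hyF, h₁, h₂⟩
  have hempty : ∀ k, c ∅ k = d 0 := fun k => by simp [c, next]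
  have hlim : ∀ F, ∃ x, Filter.Tendsto (c F) Filter.atTop (𝓝 x) := by
    intro F
    rcases F.eq_empty_or_nonempty with rfl | hF
    · exact ⟨d 0, by simpa only [funext hempty] using tendsto_const_nhds⟩
    · refine cauchySeq_tendsto_of_complete (cauchySeq_of_le_geometric (1 / 2) 2 (by norm_num) ?_)
      intro k
      obtain ⟨y, -, h₁, h₂⟩ := hpt F hF k
      have := dist_triangle_left (c F k) (c F (k + 1)) y
      have h3 : ((1 : ℝ) / 2) ^ (k + 1) = (1 / 2) ^ k / 2 := by ring
      have h4 : (0 : ℝ) < (1 / 2) ^ k := by positivity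
      linarith
  choose s hs using hlim
  refine ⟨s, fun F hFc hF => ?_, fun {Y} _ Φ hΦ => ?_⟩
  · choose y hyF hy using hpt F hF
    have : Filter.Tendsto y Filter.atTop (𝓝 (s F)) := by
      refine (tendsto_iff_of_dist ?_).2 (hs F)
      refine squeeze_zero (fun _ => dist_nonneg) (fun k => (hy k).1.le) ?_
      exact tendsto_pow_atTop_nhds_zero_of_lt_one (by norm_num) (by norm_num)
    exact hFc.mem_of_tendsto this (Filter.Eventually.of_forall hyF)
  · have hnext : ∀ l n, MeasurableSet {y | next (Φ y) l = n} := by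
      intro l n
      have hm : ∀ m, MeasurableSet {y | (Φ y ∩ O (m :: l)).Nonempty} :=
        fun m => hΦ (O (m :: l)) (hO (m :: l))
      have : {y | next (Φ y) l = n} = {y | ((Φ y ∩ O (n :: l)).Nonempty ∧
          ∀ m, m < n → ¬ (Φ y ∩ O (m :: l)).Nonempty) ∨
          (n = 0 ∧ ∀ m, ¬ (Φ y ∩ O (m :: l)).Nonempty)} := by
        ext y
        constructor
        · rintro rfl
          by_cases h : {m | (Φ y ∩ O (m :: l)).Nonempty}.Nonempty
          · exact Or.inl ⟨Nat.sInf_mem h, fun m hm => Nat.notMem_of_lt_sInf hm⟩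
          · have h' : {m | (Φ y ∩ O (m :: l)).Nonempty} = ∅ := not_nonempty_iff_eq_empty.1 h
            refine Or.inr ⟨?_, fun m hm => h ⟨m, hm⟩⟩
            simp only [next]
            rw [h', Nat.sInf_empty]
        · rintro (⟨h₁, h₂⟩ | ⟨rfl, h⟩)
          · refine le_antisymm (Nat.sInf_le h₁) ?_
            by_contra! hlt
            exact h₂ _ hlt (Nat.sInf_mem (s := {m | (Φ y ∩ O (m :: l)).Nonempty}) ⟨n, h₁⟩)
          · have h' : {m | (Φ y ∩ O (m :: l)).Nonempty} = ∅ := eq_empty_of_forall_notMem h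
            change sInf {m | (Φ y ∩ O (m :: l)).Nonempty} = 0
            rw [h', Nat.sInf_empty]
      rw [this]
      measurability
    have hstm : ∀ k l, MeasurableSet {y | st (Φ y) k = l} := by
      intro k
      induction k with
      | zero => intro l; simp [hst₀]
      | succ k ih =>
        intro l
        rcases l with _ | ⟨n, l⟩
        · simp [hst]
        · have : {y | st (Φ y) (k + 1) = n :: l} =
              {y | st (Φ y) k = l} ∩ {y | next (Φ y) l = n} := by
            ext y
            simp only [hst, List.cons.injEq, mem_inter_iff]
            change next _ _ = n ∧ st _ _ = l ↔ st _ _ = l ∧ next _ _ = n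
            constructor
            · rintro ⟨h, rfl⟩; exact ⟨rfl, h⟩
            · rintro ⟨rfl, h⟩; exact ⟨h, rfl⟩
          rw [this]
          exact (ih l).inter (hnext l n)
    refine measurable_of_tendsto_metrizable (f := fun k y => c (Φ y) k) (fun k => ?_)
      (tendsto_pi_nhds.2 fun y => hs (Φ y))
    intro A _
    have : (fun y => c (Φ y) k) ⁻¹' A =
        ⋃ (l : List ℕ) (n : ℕ) (_ : d n ∈ A),
          {y | st (Φ y) k = l} ∩ {y | next (Φ y) l = n} := by
      ext y
      simp only [mem_iUnion, mem_inter_iff]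
      constructor
      · intro h
        exact ⟨_, _, h, rfl, rfl⟩
      · rintro ⟨l, n, hn, h₁, h₂⟩
        change st _ _ = l at h₁
        change next _ _ = n at h₂
        subst h₁ h₂
        exact hn
    rw [this]
    exact MeasurableSet.iUnion fun l => .iUnion fun n => .iUnion fun _ =>
      (hstm k l).inter (hnext l n)

end Selection

section LocallyCompactAction

variable {G X : Type*} [Group G] [TopologicalSpace G] [TopologicalSpace X] [MulAction G X]

theorem isClosed_exists_mem_compact {α Z : Type*} [TopologicalSpace α] [TopologicalSpace Z]
    {K : Set α} (hK : IsCompact K)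
    {D : Set (α × Z)} (hD : IsClosed D) : IsClosed {z | ∃ g ∈ K, (g, z) ∈ D} := by
  have := isCompact_iff_compactSpace.1 hK
  have h := isClosedMap_snd_of_compactSpace (X := K) (Y := Z) _
    (hD.preimage (f := fun p : K × Z => ((p.1 : α), p.2)) (by fun_prop))
  convert h using 1
  ext z
  constructor
  · rintro ⟨g, hg, h⟩
    exact ⟨(⟨g, hg⟩, z), h, rfl⟩
  · rintro ⟨⟨g, z⟩, h, rfl⟩
    exact ⟨g, g.2, h⟩

/-- Points of `A` that are `U³`-equivalent are `U`-equivalent. -/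
def IsRigid (U : Set G) (A : Set X) : Prop :=
  ∀ y ∈ A, ∀ g ∈ U * U * U, g • y ∈ A → ∃ u ∈ U, u • y = g • y

theorem exists_isClosed_isRigid_cover [IsTopologicalGroup G] [LocallyCompactSpace G] [T2Space G]
    [SecondCountableTopology G] [PolishSpace X] [ContinuousSMul G X] [Nonempty X]
    {U : Set G} (hU : IsCompact U) (hU1 : U ∈ 𝓝 1) :
    ∃ A : ℕ → Set X, (∀ n, IsClosed (A n) ∧ IsRigid U (A n)) ∧ ∀ x, ∃ n, x ∈ A n := by
  let B : countableBasis X × Finset (countableBasis G) → Set X := fun i =>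
    closure (i.1 : Set X) ∩ ⋂ w ∈ i.2, {x | ∃ g ∈ closure (w : Set G), g • x = x}
  have hcov : ∀ x : X, ∃ i, x ∈ B i ∧ IsClosed (B i) ∧ IsRigid U (B i) := by
    intro x
    have hb : ∀ g : G, ∃ b : countableBasis G, ∃ N ∈ 𝓝 x, g ∈ (b : Set G) ∧
        (g • x = x → IsCompact (closure (b : Set G)) ∧
          ∀ a ∈ closure (b : Set G), ∀ c ∈ closure (b : Set G), a * c⁻¹ ∈ U) ∧
        (g • x ≠ x → ∀ h ∈ (b : Set G), ∀ y ∈ N, h • y ∉ N) := by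
      intro g
      by_cases hg : g • x = x
      · have h1 : {p : G × G | p.1 * p.2⁻¹ ∈ U} ∈ 𝓝 (g, g) := by
          have : Filter.Tendsto (fun p : G × G => p.1 * p.2⁻¹) (𝓝 (g, g)) (𝓝 (g * g⁻¹)) :=
            Continuous.tendsto (by fun_prop) _
          rw [mul_inv_cancel] at this
          exact this hU1
        rw [nhds_prod_eq, Filter.mem_prod_same_iff] at h1
        obtain ⟨t, ht, htU⟩ := h1
        obtain ⟨L, hL, hLt, hLc⟩ := local_compact_nhds ht
        obtain ⟨b, hb, hgb, hbL⟩ := (isBasis_countableBasis G).mem_nhds_iff.1 hL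
        have hcl : closure b ⊆ L := closure_minimal hbL hLc.isClosed
        exact ⟨⟨b, hb⟩, univ, Filter.univ_mem, hgb, fun _ =>
          ⟨hLc.of_isClosed_subset isClosed_closure hcl, fun a ha c hc =>
            htU (mk_mem_prod (hLt (hcl ha)) (hLt (hcl hc)))⟩, fun h => absurd hg h⟩
      · obtain ⟨V, W, hV, hW, hgV, hxW, hVW⟩ := t2_separation hg
        have h1 : {p : G × X | p.1 • p.2 ∈ V} ∈ 𝓝 (g, x) :=
          (continuous_smul.tendsto (g, x)) (hV.mem_nhds hgV)
        rw [mem_nhds_prod_iff] at h1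
        obtain ⟨t, ht, N, hN, htN⟩ := h1
        obtain ⟨b, hb, hgb, hbt⟩ := (isBasis_countableBasis G).mem_nhds_iff.1 ht
        refine ⟨⟨b, hb⟩, N ∩ W, Filter.inter_mem hN (hW.mem_nhds hxW), hgb, fun h => absurd h hg,
          fun _ h hh y hy hhy => ?_⟩
        exact Set.disjoint_left.1 hVW (htN (mk_mem_prod (hbt hh) hy.1)) hhy.2
    choose b N hN hgb hfix hmove using hb
    have hK : IsCompact (U * U * U) := (hU.mul hU).mul hU
    obtain ⟨t, -, htcov⟩ := hK.elim_nhds_subcover (fun g => (b g : Set G)) fun g _ =>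
      (isOpen_of_mem_countableBasis (b g).2).mem_nhds (hgb g)
    have hNt : (⋂ g ∈ t, N g) ∈ 𝓝 x := (Filter.biInter_finset_mem t).2 fun g _ => hN g
    obtain ⟨C, ⟨hC, hCc⟩, hCN⟩ := (closed_nhds_basis x).mem_iff.1 hNt
    obtain ⟨b₀, hb₀, hxb₀, hb₀C⟩ := (isBasis_countableBasis X).mem_nhds_iff.1 hC
    have hcl : closure b₀ ⊆ ⋂ g ∈ t, N g := (closure_minimal hb₀C hCc).trans hCN
    classical
    refine ⟨(⟨b₀, hb₀⟩, (t.filter fun g => g • x = x).image b), ⟨subset_closure hxb₀, ?_⟩, ?_, ?_⟩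
    · simp only [mem_iInter, Finset.mem_image, Finset.mem_filter]
      rintro _ ⟨g, ⟨-, hg⟩, rfl⟩
      exact ⟨g, subset_closure (hgb g), hg⟩
    · refine isClosed_closure.inter (isClosed_biInter fun w hw => ?_)
      obtain ⟨g, hg, rfl⟩ := Finset.mem_image.1 hw
      exact isClosed_exists_mem_compact (hfix g (Finset.mem_filter.1 hg).2).1
        (D := {p : G × X | p.1 • p.2 = p.2}) (isClosed_eq continuous_smul continuous_snd)
    · intro y hy k hk hky
      obtain ⟨g, hgt, hkb⟩ := mem_iUnion₂.1 (htcov hk)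
      have hgx : g • x = x := by
        by_contra hgx
        exact hmove g hgx k hkb y (mem_iInter₂.1 (hcl hy.1) g hgt)
          (mem_iInter₂.1 (hcl hky.1) g hgt)
      obtain ⟨w, hw, hwy⟩ := mem_iInter₂.1 hy.2 (b g)
        (Finset.mem_image_of_mem _ (Finset.mem_filter.2 ⟨hgt, hgx⟩))
      refine ⟨k * w⁻¹, (hfix g hgx).2 k (subset_closure hkb) w hw, ?_⟩
      rw [mul_smul, inv_smul_eq_iff.2 hwy.symm]
  have hcount : Countable (countableBasis X × Finset (countableBasis G)) := by
    have := (countable_countableBasis X).to_subtype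
    have := (countable_countableBasis G).to_subtype
    infer_instance
  obtain ⟨x₀⟩ := ‹Nonempty X›
  obtain ⟨i₀, -, hi₀⟩ := hcov x₀
  have hne : ({i | IsClosed (B i) ∧ IsRigid U (B i)} : Set _).Nonempty := ⟨i₀, hi₀⟩
  obtain ⟨e, he⟩ := (to_countable {i | IsClosed (B i) ∧ IsRigid U (B i)}).exists_eq_range hne
  refine ⟨fun n => B (e n), fun n => ?_, fun x => ?_⟩
  · exact he.symm.subset (mem_range_self n)
  · obtain ⟨i, hxi, hi⟩ := hcov x
    obtain ⟨n, rfl⟩ := he.subset hi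
    exact ⟨n, hxi⟩

theorem exists_countable_section [IsTopologicalGroup G] [LocallyCompactSpace G] [T2Space G]
    [SecondCountableTopology G] [PolishSpace X] [ContinuousSMul G X] [Nonempty X]
    [MeasurableSpace X] [BorelSpace X] :
    ∃ (S : Set X) (σ : X → X), MeasurableSet S ∧ Measurable σ ∧ (∀ x, σ x ∈ S) ∧
      (∀ x, ∃ g : G, σ x = g • x) ∧ ∀ x, (S ∩ MulAction.orbit G x).Countable := by
  obtain ⟨K, hK, hK1⟩ := exists_compact_mem_nhds (1 : G)
  obtain ⟨U, hU, hU1, hUinv⟩ : ∃ U : Set G, IsCompact U ∧ U ∈ 𝓝 1 ∧ ∀ u ∈ U, u⁻¹ ∈ U :=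
    ⟨K ∩ K⁻¹, hK.inter_right hK.inv.isClosed, Filter.inter_mem hK1 (inv_mem_nhds_one G hK1),
      fun u hu => ⟨hu.2, by simpa using hu.1⟩⟩
  have h1U : (1 : G) ∈ U := mem_of_mem_nhds hU1
  obtain ⟨A, hA, hcov⟩ := exists_isClosed_isRigid_cover (X := X) hU hU1
  obtain ⟨s, hs, hsm⟩ := exists_measurable_selector X
  let Φ : ℕ → X → Set X := fun n p => {q | q ∈ A n ∧ ∃ g ∈ U * U, g • p = q}
  have hΦc : ∀ n p, IsClosed (Φ n p) := fun n p => (hA n).1.inter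
    (((hU.mul hU).image (f := fun g : G => g • p) (by fun_prop)).isClosed)
  have hΦm : ∀ n, Measurable fun p => s (Φ n p) := fun n => hsm _ fun O hO => by
    let := upgradeIsCompletelyMetrizable X
    obtain ⟨F, hF, -, rfl, -⟩ := hO.exists_iUnion_isClosed
    have : {p | (Φ n p ∩ ⋃ k, F k).Nonempty} = ⋃ k, {p | ∃ g ∈ U * U, g • p ∈ A n ∩ F k} := by
      ext p
      rw [mem_iUnion]
      constructor
      · rintro ⟨_, ⟨hq, g, hg, rfl⟩, hqF⟩
        obtain ⟨k, hk⟩ := mem_iUnion.1 hqF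
        exact ⟨k, g, hg, hq, hk⟩
      · rintro ⟨k, g, hg, hq, hk⟩
        exact ⟨g • p, ⟨hq, g, hg, rfl⟩, mem_iUnion.2 ⟨k, hk⟩⟩
    rw [this]
    exact .iUnion fun k => (isClosed_exists_mem_compact (hU.mul hU)
      (D := {p : G × X | p.1 • p.2 ∈ A n ∩ F k})
      (((hA n).1.inter (hF k)).preimage continuous_smul)).measurableSet
  have hΦU : ∀ n, ∀ y ∈ A n, ∀ u ∈ U, Φ n (u • y) = {q | q ∈ A n ∧ ∃ u ∈ U, u • y = q} := by
    intro n y hy u hu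
    ext q
    constructor
    · rintro ⟨hq, g, hg, rfl⟩
      rw [smul_smul] at hq ⊢
      exact ⟨hq, (hA n).2 y hy _ (mul_mem_mul hg hu) hq⟩
    · rintro ⟨hq, v, hv, rfl⟩
      exact ⟨hq, v * u⁻¹, mul_mem_mul hv (hUinv u hu), by simp [mul_smul]⟩
  have hΦU' : ∀ n, ∀ y ∈ A n, ∀ u ∈ U, Φ n (u • y) = Φ n y := by
    intro n y hy u hu
    rw [hΦU n y hy u hu, ← hΦU n y hy 1 h1U, one_smul]
  have hsel : ∀ n, ∀ y ∈ A n, ∃ u ∈ U, s (Φ n y) = u • y := by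
    intro n y hy
    have h := hs (Φ n y) (hΦc n y) ⟨y, hy, 1, by simpa using mul_mem_mul h1U h1U, one_smul _ _⟩
    have h2 := hΦU n y hy 1 h1U
    rw [one_smul] at h2
    rw [h2] at h ⊢
    obtain ⟨-, u, hu, huy⟩ := h
    exact ⟨u, hu, huy.symm⟩
  let S : ℕ → Set X := fun n => {p | (∃ u ∈ U, u • p ∈ A n) ∧ s (Φ n p) = p}
  classical
  refine ⟨⋃ n, S n, fun x => s (Φ (Nat.find (hcov x)) x), .iUnion fun n => ?_,
    Measurable.find (f := fun n x => s (Φ n x)) (p := fun n x => x ∈ A n) hΦm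
      (fun n => (hA n).1.measurableSet) hcov,
    fun x => mem_iUnion.2 ⟨Nat.find (hcov x), ?_⟩, fun x => ?_, fun x => ?_⟩
  · refine MeasurableSet.inter ?_ (measurableSet_eq_fun (hΦm n) measurable_id)
    exact (isClosed_exists_mem_compact hU (D := {p : G × X | p.1 • p.2 ∈ A n})
      ((hA n).1.preimage continuous_smul)).measurableSet
  · have hx := Nat.find_spec (hcov x)
    obtain ⟨u, hu, hux⟩ := hsel _ x hx
    beta_reduce
    refine ⟨⟨u⁻¹, hUinv u hu, ?_⟩, ?_⟩
    · rw [hux, inv_smul_smul]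
      exact hx
    · conv_lhs => rw [hux, hΦU' _ x hx u hu]
  · obtain ⟨u, -, hux⟩ := hsel _ x (Nat.find_spec (hcov x))
    exact ⟨u, hux⟩
  · obtain ⟨V, hV, hVU⟩ : ∃ V ∈ 𝓝 (1 : G), ∀ a ∈ V, ∀ b ∈ V, a * b⁻¹ ∈ U := by
      obtain ⟨V, hV, hVU⟩ := exists_nhds_split_inv hU1
      exact ⟨V, hV, fun a ha b hb => by simpa [div_eq_mul_inv] using hVU a ha b hb⟩
    obtain ⟨T, hT, hTcov⟩ := countable_cover_nhds (f := fun g : G => {h | h * g⁻¹ ∈ V}) fun g => by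
      have : Filter.Tendsto (fun h : G => h * g⁻¹) (𝓝 g) (𝓝 (g * g⁻¹)) :=
        Continuous.tendsto (by fun_prop) _
      rw [mul_inv_cancel] at this
      exact this hV
    rw [iUnion_inter]
    refine countable_iUnion fun n => ?_
    have : S n ∩ MulAction.orbit G x ⊆ ⋃ g ∈ T, {p ∈ S n | ∃ h, h * g⁻¹ ∈ V ∧ h • x = p} := by
      rintro _ ⟨hp, h, rfl⟩
      obtain ⟨g, hg, hgV⟩ := mem_iUnion₂.1 (hTcov.symm.subset (mem_univ h))
      exact mem_iUnion₂.2 ⟨g, hg, hp, h, hgV, rfl⟩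
    refine Countable.mono this (hT.biUnion fun g _ => Set.Subsingleton.countable ?_)
    rintro _ ⟨⟨⟨u, hu, hy⟩, hp⟩, h, hhV, rfl⟩ _ ⟨⟨⟨u', hu', hy'⟩, hp'⟩, h', hhV', rfl⟩
    have hyy : u' • h' • x = (u' * (h' * h⁻¹) * u⁻¹) • u • h • x := by
      simp only [← mul_smul]
      congr 1
      group
    have hmem : u' * (h' * h⁻¹) * u⁻¹ ∈ U * U * U := by
      refine mul_mem_mul (mul_mem_mul hu' ?_) (hUinv u hu)
      have := hVU _ hhV' _ hhV
      simpa [mul_assoc] using this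
    obtain ⟨v, hv, hvy⟩ := (hA n).2 _ hy _ hmem (hyy ▸ hy')
    have e1 := hΦU' n _ hy u⁻¹ (hUinv u hu)
    have e2 := hΦU' n _ hy' u'⁻¹ (hUinv u' hu')
    have e3 := hΦU' n _ hy v hv
    rw [inv_smul_smul] at e1 e2
    rw [hvy, ← hyy] at e3
    rw [← hp, ← hp', e1, e2, e3]

end LocallyCompactAction

section Units

variable {n : ℕ}

instance secondCountableTopology_units_matrix :
    SecondCountableTopology (Matrix (Fin n) (Fin n) ℝ)ˣ := by
  have : SecondCountableTopology (Matrix (Fin n) (Fin n) ℝ) :=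
    inferInstanceAs (SecondCountableTopology (Fin n → Fin n → ℝ))
  have : SecondCountableTopology (Matrix (Fin n) (Fin n) ℝ)ᵐᵒᵖ :=
    MulOpposite.opHomeomorph.symm.isEmbedding.secondCountableTopology
  exact Units.isEmbedding_embedProduct.secondCountableTopology

instance locallyCompactSpace_units_matrix :
    LocallyCompactSpace (Matrix (Fin n) (Fin n) ℝ)ˣ := by
  have : LocallyCompactSpace (Matrix (Fin n) (Fin n) ℝ) :=
    inferInstanceAs (LocallyCompactSpace (Fin n → Fin n → ℝ))
  infer_instance

end Units

theorem FellSpace.exists_countableBorelER (G : Type) [Group G] [TopologicalSpace G]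
    [IsTopologicalGroup G] [LocallyCompactSpace G] [T2Space G] [SecondCountableTopology G] :
    ∃ (C : CountableBorelER.{0}) (f : FellSpace G → C.carrier), Measurable f ∧
      ∀ A B, (∃ g : G, g • A = B) ↔ C.rel (f A) (f B) := by
  have : Nonempty (FellSpace G) := ⟨(⊥ : Closeds G)⟩
  obtain ⟨S, σ, hS, hσ, hσS, hσG, hcount⟩ := exists_countable_section (G := G) (X := FellSpace G)
  refine ⟨⟨FellSpace G, inferInstance, inferInstance,
    fun x y => x = y ∨ x ∈ S ∧ y ∈ S ∧ ∃ g : G, g • x = y, ⟨fun x => Or.inl rfl, ?_, ?_⟩, ?_, ?_⟩,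
    σ, hσ, fun A B => ?_⟩
  · rintro x y (rfl | ⟨hx, hy, g, rfl⟩)
    · exact Or.inl rfl
    · exact Or.inr ⟨hy, hx, g⁻¹, by simp⟩
  · rintro x y z (rfl | ⟨hx, hy, g, rfl⟩) (rfl | ⟨hx', hy', g', rfl⟩)
    · exact Or.inl rfl
    · exact Or.inr ⟨hx', hy', g', rfl⟩
    · exact Or.inr ⟨hx, hy, g, rfl⟩
    · exact Or.inr ⟨hx, hy', g' * g, mul_smul _ _ _⟩
  · have h : MeasurableSet {p : FellSpace G × FellSpace G | ∃ g : G, g • p.1 = p.2} := by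
      have : {p : FellSpace G × FellSpace G | ∃ g : G, g • p.1 = p.2} =
          ⋃ n, {p | ∃ g ∈ compactCovering G n, g • p.1 = p.2} := by
        ext p
        rw [mem_iUnion]
        constructor
        · rintro ⟨g, hg⟩
          obtain ⟨n, hn⟩ := mem_iUnion.1 ((iUnion_compactCovering G).symm.subset (mem_univ g))
          exact ⟨n, g, hn, hg⟩
        · rintro ⟨n, g, -, hg⟩
          exact ⟨g, hg⟩
      rw [this]
      exact .iUnion fun n => (isClosed_exists_mem_compact (isCompact_compactCovering G n)
        (D := {q : G × FellSpace G × FellSpace G | q.1 • q.2.1 = q.2.2})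
        (isClosed_eq (by fun_prop) (by fun_prop))).measurableSet
    exact (measurableSet_eq_fun measurable_fst measurable_snd).union
      ((measurable_fst hS).inter ((measurable_snd hS).inter h))
  · intro z
    refine ((countable_singleton z).union (hcount z)).mono ?_
    rintro w (rfl | ⟨-, hw, g, rfl⟩)
    · exact Or.inl rfl
    · exact Or.inr ⟨hw, g, rfl⟩
  · obtain ⟨a, ha⟩ := hσG A
    obtain ⟨b, hb⟩ := hσG B
    constructor
    · rintro ⟨g, rfl⟩
      exact Or.inr ⟨hσS _, hσS _, b * g * a⁻¹, by simp [ha, hb, mul_smul]⟩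
    · intro h
      obtain ⟨g, hg⟩ : ∃ g : G, g • σ A = σ B := by
        rcases h with h | ⟨-, -, h⟩
        exacts [⟨1, by rwa [one_smul]⟩, h]
      refine ⟨b⁻¹ * g * a, ?_⟩
      rw [mul_smul, mul_smul, ← ha, hg, hb, inv_smul_smul]

theorem exists_borelReducible_countableBorelER {n : ℕ}
    (G : Subgroup (Matrix (Fin n) (Fin n) ℝ)ˣ)
    (hG : IsClosed (G : Set (Matrix (Fin n) (Fin n) ℝ)ˣ)) :
    ∃ C : CountableBorelER.{0},
      @BorelReducible _ _ (torsionFreeDiscreteBorel G) C.inst (conjugacyRel G) C.rel := by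
  have : LocallyCompactSpace G := hG.isClosedEmbedding_subtypeVal.locallyCompactSpace
  have : SecondCountableTopology G :=
    hG.isClosedEmbedding_subtypeVal.isEmbedding.secondCountableTopology
  obtain ⟨C, f, hf, hfC⟩ := FellSpace.exists_countableBorelER G
  refine ⟨C, fun F => f F.1, ?_, fun A B => ?_⟩
  · exact hf.comp (comap_measurable (m := fellBorel G) Subtype.val)
  · exact (exists_congr fun g => (FellSpace.smul_eq_iff g A.1 B.1).symm).trans (hfC A.1 B.1)

theorem MeasureTheory.AnalyticSet.inter {α : Type*} [TopologicalSpace α] [T2Space α] {s t : Set α}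
    (hs : AnalyticSet s) (ht : AnalyticSet t) : AnalyticSet (s ∩ t) := by
  rw [inter_eq_iInter]
  exact AnalyticSet.iInter fun b => by cases b <;> assumption

namespace LusinNovikov

variable {W X : Type*} [MeasurableSpace W]

/-- `B` is a countable union of Borel sets on which `π` is injective. -/
def IsSmall (π : W → X) (B : Set W) : Prop :=
  ∃ C : ℕ → Set W, (∀ n, MeasurableSet (C n) ∧ InjOn π (C n)) ∧ B = ⋃ n, C n

theorem IsSmall.iUnion {π : W → X} {B : ℕ → Set W} (hB : ∀ n, IsSmall π (B n)) :
    IsSmall π (⋃ n, B n) := by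
  choose C hC hBC using hB
  refine ⟨fun k => C k.unpair.1 k.unpair.2, fun k => hC _ _, ?_⟩
  simp only [hBC]
  exact (iUnion_unpair C).symm

theorem IsSmall.union {π : W → X} {B C : Set W} (hB : IsSmall π B) (hC : IsSmall π C) :
    IsSmall π (B ∪ C) := by
  have : B ∪ C = ⋃ n : ℕ, if n = 0 then B else C := by
    ext w
    simp only [mem_union, mem_iUnion]
    constructor
    · rintro (h | h)
      exacts [⟨0, h⟩, ⟨1, h⟩]
    · rintro ⟨n, h⟩
      split_ifs at h
      exacts [Or.inl h, Or.inr h]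
  rw [this]
  refine IsSmall.iUnion fun n => ?_
  split_ifs
  exacts [hB, hC]

theorem isSmall_of_injOn {π : W → X} {B : Set W} (hB : MeasurableSet B) (h : InjOn π B) :
    IsSmall π B :=
  ⟨fun _ => B, fun _ => ⟨hB, h⟩, (iUnion_const B).symm⟩

/-- Sequences from `Z` cannot be blocked by a small set. -/
def IsLarge (π : W → X) (Z : Set (ℕ → W)) : Prop :=
  ∀ B, IsSmall π B → ∃ z ∈ Z, ∀ j, z j ∉ B

theorem IsLarge.exists_of_iUnion {ι : Type*} [Countable ι] {π : W → X} {Z : ι → Set (ℕ → W)}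
    (h : IsLarge π (⋃ i, Z i)) : ∃ i, IsLarge π (Z i) := by
  by_contra! hn
  have hne : Nonempty ι := by
    obtain ⟨z, hz, -⟩ := h ∅ ⟨fun _ => ∅, fun _ => ⟨.empty, injOn_empty π⟩, by simp⟩
    exact (mem_iUnion.1 hz).nonempty
  simp only [IsLarge, not_forall, exists_prop] at hn
  push Not at hn
  choose B hB hZ using hn
  obtain ⟨e, he⟩ := exists_surjective_nat ι
  obtain ⟨z, hz, hzB⟩ := h _ (IsSmall.iUnion fun n => hB (e n))
  obtain ⟨i, hi⟩ := mem_iUnion.1 hz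
  obtain ⟨n, rfl⟩ := he i
  obtain ⟨j, hj⟩ := hZ _ z hi
  exact hzB j (mem_iUnion.2 ⟨n, hj⟩)

variable [TopologicalSpace X] [T2Space X]

theorem exists_measurableSet_injOn_of_analyticSet [TopologicalSpace W] [PolishSpace W]
    [BorelSpace W] {π : W → X} (hπ : Continuous π)
    {A : Set W} (hA : AnalyticSet A) (hinj : InjOn π A) :
    ∃ C, A ⊆ C ∧ MeasurableSet C ∧ InjOn π C := by
  borelize X
  have hsep : ∀ b : countableBasis W, ∃ u, π '' (A ∩ b) ⊆ u ∧ Disjoint (π '' (A ∩ (b : Set W)ᶜ)) u ∧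
      MeasurableSet u := fun b => by
    have hb := isOpen_of_mem_countableBasis b.2
    refine AnalyticSet.measurablySeparable
      ((hA.inter hb.measurableSet.analyticSet).image_of_continuous hπ)
      ((hA.inter hb.measurableSet.compl.analyticSet).image_of_continuous hπ) ?_
    refine Set.disjoint_left.2 ?_
    rintro _ ⟨w, ⟨hw, hwb⟩, rfl⟩ ⟨w', ⟨hw', hwb'⟩, h⟩
    exact hwb' (hinj hw' hw h ▸ hwb)
  choose u h₁ h₂ h₃ using hsep
  have := (countable_countableBasis W).to_subtype
  refine ⟨⋂ b : countableBasis W, {w | w ∈ (b : Set W) ↔ π w ∈ u b}, fun w hw => ?_, ?_, ?_⟩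
  · refine mem_iInter.2 fun b => ⟨fun hb => h₁ b ⟨w, ⟨hw, hb⟩, rfl⟩, fun hu => ?_⟩
    by_contra hb
    exact Set.disjoint_left.1 (h₂ b) ⟨w, ⟨hw, hb⟩, rfl⟩ hu
  · refine .iInter fun b => ?_
    exact MeasurableSet.iff (isOpen_of_mem_countableBasis b.2).measurableSet
      (hπ.measurable (h₃ b))
  · intro w hw w' hw' h
    by_contra hne
    obtain ⟨b, hb, hwb, hbw⟩ := (isBasis_countableBasis W).mem_nhds_iff.1
      (isOpen_compl_singleton.mem_nhds hne)
    have e := mem_iInter.1 hw ⟨b, hb⟩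
    have e' := mem_iInter.1 hw' ⟨b, hb⟩
    exact hbw (e'.2 (h ▸ e.1 hwb)) rfl

theorem IsLarge.step [MetricSpace W] [CompleteSpace W] [SecondCountableTopology W]
    [BorelSpace W] {π : W → X} (hπ : Continuous π) {Z : Set (ℕ → W)} (hZ : AnalyticSet Z)
    (hcoh : ∀ z ∈ Z, ∀ j, π (z j) = π (z 0)) (hl : IsLarge π Z) {t m : ℕ} (htm : t < m)
    {ε : ℝ} (hε : 0 < ε) :
    ∃ Z' : Set (ℕ → W), (AnalyticSet Z' ∧ (∀ z ∈ Z', ∀ j, π (z j) = π (z 0)) ∧ IsLarge π Z') ∧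
      (∀ z' ∈ Z', ∃ z ∈ Z, ∀ j, j ≠ m → z' j = z j) ∧ (∀ z' ∈ Z', ∃ z ∈ Z, z' m = z t) ∧
      (∃ δ > 0, ∀ z' ∈ Z', δ ≤ dist (z' m) (z' t)) ∧
      ∀ z ∈ Z', ∀ z' ∈ Z', ∀ j ≤ m, dist (z j) (z' j) ≤ ε := by
  let D : Set ((ℕ → W) × (ℕ → W)) :=
    Prod.fst ⁻¹' Z ∩ Prod.snd ⁻¹' Z ∩ ({p | π (p.1 0) = π (p.2 0)} ∩ {p | p.1 t ≠ p.2 t})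
  let up : (ℕ → W) × (ℕ → W) → ℕ → W := fun p => Function.update p.1 m (p.2 t)
  have hup : Continuous up := continuous_fst.update m ((continuous_apply t).comp continuous_snd)
  have hD : AnalyticSet D := by
    refine ((hZ.preimage continuous_fst).inter (hZ.preimage continuous_snd)).inter ?_
    exact ((isClosed_eq (by fun_prop) (by fun_prop)).measurableSet.inter
      (isOpen_ne_fun (by fun_prop) (by fun_prop)).measurableSet).analyticSet
  have hlarge : IsLarge π (up '' D) := by
    intro B hB
    by_contra! hn
    have hBm : MeasurableSet B := by
      obtain ⟨C, hC, rfl⟩ := hB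
      exact .iUnion fun n => (hC n).1
    let Z₁ : Set (ℕ → W) := Z ∩ ⋂ j, {z | z j ∉ B}
    have hZ₁ : AnalyticSet Z₁ := hZ.inter
      (MeasurableSet.iInter fun j => (measurable_pi_apply j) hBm.compl).analyticSet
    obtain ⟨C, hAC, hC, hCinj⟩ := exists_measurableSet_injOn_of_analyticSet hπ
      (hZ₁.image_of_continuous (continuous_apply t)) (by
        rintro _ ⟨z, ⟨hz, hzB⟩, rfl⟩ _ ⟨z', ⟨hz', hzB'⟩, rfl⟩ h
        by_contra hne
        beta_reduce at h hne
        rw [hcoh z hz, hcoh z' hz'] at h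
        obtain ⟨j, hj⟩ := hn _ ⟨(z, z'), ⟨⟨hz, hz'⟩, h, hne⟩, rfl⟩
        simp only [up, Function.update_apply] at hj
        split_ifs at hj
        · exact mem_iInter.1 hzB' t hj
        · exact mem_iInter.1 hzB j hj)
    obtain ⟨z, hz, hzB⟩ := hl _ (hB.union (isSmall_of_injOn hC hCinj))
    refine hzB t (Or.inr (hAC ⟨z, ⟨hz, mem_iInter.2 fun j hj => hzB j (Or.inl hj)⟩, rfl⟩))
  have hne : Nonempty W := by
    obtain ⟨z, -, -⟩ := hl ∅ ⟨fun _ => ∅, fun _ => ⟨.empty, injOn_empty π⟩, by simp⟩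
    exact ⟨z 0⟩
  let d := denseSeq W
  have hd : DenseRange d := denseRange_denseSeq W
  let Q : (Fin (m + 1) → ℕ) × ℕ → Set (ℕ → W) := fun i =>
    (⋂ j : Fin (m + 1), {z | dist (z j) (d (i.1 j)) ≤ ε / 2}) ∩
      {z | 1 / ((i.2 : ℝ) + 1) ≤ dist (z m) (z t)}
  have hQ : ∀ i, IsClosed (Q i) := fun i =>
    (isClosed_iInter fun j => isClosed_le (by fun_prop) continuous_const).inter
      (isClosed_le continuous_const (by fun_prop))
  have hcov : up '' D = ⋃ i, up '' D ∩ Q i := by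
    rw [← inter_iUnion, eq_comm, inter_eq_left]
    rintro _ ⟨p, ⟨-, -, hp⟩, rfl⟩
    have hpos : 0 < dist (up p m) (up p t) := by
      rw [dist_pos]
      simpa [up, htm.ne] using hp.symm
    obtain ⟨l, hl⟩ := exists_nat_one_div_lt hpos
    have : ∀ j : Fin (m + 1), ∃ k, dist (up p j) (d k) ≤ ε / 2 := fun j => by
      obtain ⟨k, hk⟩ := hd.exists_dist_lt (up p j) (half_pos hε)
      exact ⟨k, hk.le⟩
    choose k hk using this
    exact mem_iUnion.2 ⟨(k, l), mem_iInter.2 hk, hl.le⟩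
  rw [hcov] at hlarge
  obtain ⟨⟨k, l⟩, hi⟩ := hlarge.exists_of_iUnion
  refine ⟨up '' D ∩ Q (k, l), ⟨(hD.image_of_continuous hup).inter (hQ _).analyticSet, ?_, hi⟩,
    ?_, ?_, ⟨1 / ((l : ℝ) + 1), by positivity, fun z hz => hz.2.2⟩, ?_⟩
  · rintro _ ⟨⟨⟨z, z'⟩, ⟨⟨hz, hz'⟩, h, -⟩, rfl⟩, -⟩ j
    have hm : (0 : ℕ) ≠ m := by omega
    simp only [up, Function.update_apply, hm, if_false]
    split_ifs
    · exact (hcoh z' hz' t).trans h.symm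
    · exact hcoh z hz j
  · rintro _ ⟨⟨⟨z, z'⟩, ⟨⟨hz, hz'⟩, -⟩, rfl⟩, -⟩
    exact ⟨z, hz, fun j hj => Function.update_of_ne hj _ _⟩
  · rintro _ ⟨⟨⟨z, z'⟩, ⟨⟨hz, hz'⟩, -⟩, rfl⟩, -⟩
    exact ⟨z', hz', Function.update_self _ _ _⟩
  · rintro z ⟨-, hz, -⟩ z' ⟨-, hz', -⟩ j hj
    have h₁ : dist (z j) (d (k ⟨j, by omega⟩)) ≤ ε / 2 := mem_iInter.1 hz ⟨j, by omega⟩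
    have h₂ : dist (z' j) (d (k ⟨j, by omega⟩)) ≤ ε / 2 := mem_iInter.1 hz' ⟨j, by omega⟩
    linarith [dist_triangle_right (z j) (z' j) (d (k ⟨j, by omega⟩))]

end LusinNovikov

namespace LusinNovikov

variable {W X : Type*} [MeasurableSpace W]

theorem isSmall_univ_of_continuous [TopologicalSpace X] [T2Space X] [TopologicalSpace W]
    [PolishSpace W] [BorelSpace W] {π : W → X} (hπ : Continuous π)
    (hcount : ∀ x, (π ⁻¹' {x}).Countable) : IsSmall π univ := by
  let := upgradeIsCompletelyMetrizable W
  by_contra hns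
  let St := {Z : Set (ℕ → W) // AnalyticSet Z ∧ (∀ z ∈ Z, ∀ j, π (z j) = π (z 0)) ∧ IsLarge π Z}
  let Z₀ : St := ⟨range fun (w : W) (_ : ℕ) => w, by
      rw [← image_univ]
      exact isClosed_univ.analyticSet.image_of_continuous (by fun_prop), by
      rintro _ ⟨w, rfl⟩ j; rfl, by
      intro B hB
      have : B ≠ univ := fun h => hns (h ▸ hB)
      obtain ⟨w, hw⟩ := (ne_univ_iff_exists_notMem B).1 this
      exact ⟨_, ⟨w, rfl⟩, fun _ => hw⟩⟩
  have hstep : ∀ (m : ℕ) (Z : St), ∃ Z' : St,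
      (∀ z' ∈ Z'.1, ∃ z ∈ Z.1, ∀ j, j ≠ m + 1 → z' j = z j) ∧
      (∀ z' ∈ Z'.1, ∃ z ∈ Z.1, z' (m + 1) = z m.unpair.1) ∧
      (∃ δ > 0, ∀ z' ∈ Z'.1, δ ≤ dist (z' (m + 1)) (z' m.unpair.1)) ∧
      ∀ z ∈ Z'.1, ∀ z' ∈ Z'.1, ∀ j ≤ m + 1, dist (z j) (z' j) ≤ (1 / 2 : ℝ) ^ m := by
    intro m Z
    obtain ⟨Z', h, h'⟩ := Z.2.2.2.step hπ Z.2.1 Z.2.2.1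
      (Nat.lt_succ_of_le (Nat.unpair_left_le m)) (ε := (1 / 2 : ℝ) ^ m) (by positivity)
    exact ⟨⟨Z', h⟩, h'⟩
  choose N hN₁ hN₂ hN₃ hN₄ using hstep
  obtain ⟨Z, -, hZ⟩ : ∃ Z : ℕ → St, Z 0 = Z₀ ∧ ∀ m, Z (m + 1) = N m (Z m) :=
    ⟨fun m => m.rec Z₀ N, rfl, fun _ => rfl⟩
  have hne : ∀ m, ∃ z, z ∈ (Z m).1 := fun m => by
    obtain ⟨z, hz, -⟩ := (Z m).2.2.2 ∅ ⟨fun _ => ∅, fun _ => ⟨.empty, injOn_empty π⟩, by simp⟩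
    exact ⟨z, hz⟩
  choose z hz using hne
  have hdesc : ∀ m k, ∀ u ∈ (Z (m + k)).1, ∃ v ∈ (Z m).1, ∀ j ≤ m, v j = u j := by
    intro m k
    induction k with
    | zero => exact fun u hu => ⟨u, hu, fun _ _ => rfl⟩
    | succ k ih =>
      intro u hu
      rw [← add_assoc, hZ] at hu
      obtain ⟨u', hu', h⟩ := hN₁ _ _ u hu
      obtain ⟨v, hv, h'⟩ := ih u' hu'
      exact ⟨v, hv, fun j hj => (h' j hj).trans (h j (by omega)).symm⟩
  have hdist : ∀ m k, ∀ u ∈ (Z (m + 1)).1, ∀ v ∈ (Z (m + 1 + k)).1, ∀ j ≤ m + 1,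
      dist (u j) (v j) ≤ (1 / 2 : ℝ) ^ m := by
    intro m k u hu v hv j hj
    obtain ⟨v', hv', h⟩ := hdesc _ _ v hv
    rw [← h j hj]
    rw [hZ] at hu hv'
    exact hN₄ m _ u hu v' hv' j hj
  have hlim : ∀ j, ∃ y, Filter.Tendsto (fun n => z n j) Filter.atTop (𝓝 y) := by
    intro j
    refine cauchySeq_tendsto_of_complete (Metric.cauchySeq_iff'.2 fun ε hε => ?_)
    obtain ⟨m, hm⟩ := exists_pow_lt_of_lt_one hε (show (1 / 2 : ℝ) < 1 by norm_num)
    refine ⟨m + j + 1, fun n hn => ?_⟩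
    obtain ⟨k, rfl⟩ := Nat.exists_eq_add_of_le hn
    rw [dist_comm]
    refine (hdist (m + j) k _ (hz _) _ (hz _) j (by omega)).trans_lt (lt_of_le_of_lt ?_ hm)
    exact pow_le_pow_of_le_one (by norm_num) (by norm_num) (by omega)
  choose y hy using hlim
  have hyd : ∀ m, ∀ u ∈ (Z (m + 1)).1, ∀ j ≤ m + 1, dist (u j) (y j) ≤ (1 / 2 : ℝ) ^ m := by
    intro m u hu j hj
    refine le_of_tendsto (tendsto_const_nhds.dist (hy j)) ?_
    filter_upwards [Filter.eventually_ge_atTop (m + 1)] with n hn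
    obtain ⟨k, rfl⟩ := Nat.exists_eq_add_of_le hn
    exact hdist m k u hu _ (hz _) j hj
  have hπy : ∀ j, π (y j) = π (y 0) := fun j => by
    refine tendsto_nhds_unique ((hπ.tendsto _).comp (hy j)) ?_
    convert (hπ.tendsto _).comp (hy 0) using 1
    ext n
    exact (Z n).2.2.1 _ (hz n) j
  have hyne : ∀ m : ℕ, y (m + 1) ≠ y m.unpair.1 := fun m => by
    obtain ⟨δ, hδ, h⟩ := hN₃ m (Z m)
    rw [← dist_pos]
    refine hδ.trans_le (ge_of_tendsto ((hy _).dist (hy _)) ?_)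
    filter_upwards [Filter.eventually_ge_atTop (m + 1)] with n hn
    obtain ⟨k, rfl⟩ := Nat.exists_eq_add_of_le hn
    obtain ⟨v, hv, hvz⟩ := hdesc (m + 1) k _ (hz _)
    rw [← hvz _ le_rfl, ← hvz _ ((Nat.unpair_left_le m).trans (Nat.le_succ m))]
    exact h v (by rwa [← hZ])
  have hynear : ∀ m : ℕ, dist (y (m + 2)) (y (m + 1).unpair.1) ≤ 3 * (1 / 2 : ℝ) ^ m := by
    intro m
    have hz' := hz (m + 2)
    have h₁ := hyd (m + 1) _ hz' (m + 2) le_rfl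
    rw [hZ] at hz'
    obtain ⟨v, hv, hvz⟩ := hN₂ (m + 1) _ _ hz'
    have h₂ := hyd m v hv (m + 1).unpair.1 (Nat.unpair_left_le _)
    rw [← hvz] at h₂
    have h₃ := dist_triangle_left (y (m + 2)) (y (m + 1).unpair.1) (z (m + 2) (m + 2))
    have h₄ : (1 / 2 : ℝ) ^ (m + 1) = (1 / 2) ^ m / 2 := by ring
    have h₅ : (0 : ℝ) < (1 / 2) ^ m := by positivity
    have h₆ : z (m + 2) (m + 1 + 1) = z (m + 2) (m + 2) := rfl
    rw [h₆] at h₂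
    linarith
  have hpre : Preperfect (range y) := by
    rw [preperfect_iff_nhds]
    rintro _ ⟨t, rfl⟩ U hU
    obtain ⟨ε, hε, hεU⟩ := Metric.mem_nhds_iff.1 hU
    obtain ⟨l, hl⟩ := exists_pow_lt_of_lt_one (show 0 < ε / 3 by positivity)
      (show (1 / 2 : ℝ) < 1 by norm_num)
    obtain ⟨m, hm⟩ : ∃ m, Nat.pair t (l + 1) = m + 1 :=
      Nat.exists_eq_succ_of_ne_zero (by have := Nat.right_le_pair t (l + 1); omega)
    have hlm : l ≤ m := by have := Nat.right_le_pair t (l + 1); omega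
    have ht : (m + 1).unpair.1 = t := by rw [← hm, Nat.unpair_pair]
    refine ⟨y (m + 2), ⟨hεU ?_, mem_range_self _⟩, ?_⟩
    · have h₁ := hynear m
      rw [ht] at h₁
      have h₂ : (1 / 2 : ℝ) ^ m ≤ (1 / 2) ^ l :=
        pow_le_pow_of_le_one (by norm_num) (by norm_num) hlm
      exact Metric.mem_ball.2 (by linarith)
    · have := hyne (m + 1)
      rwa [ht] at this
  obtain ⟨f, hf, -, hfi⟩ := hpre.perfect_closure.exists_nat_bool_injection
    (range_nonempty y).closure
  have hsub : closure (range y) ⊆ π ⁻¹' {π (y 0)} := by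
    refine closure_minimal ?_ (isClosed_singleton.preimage hπ)
    rintro _ ⟨j, rfl⟩
    exact hπy j
  have h := ((hcount (π (y 0))).mono (hf.trans hsub))
  have : Countable (ℕ → Bool) := by
    have := h.to_subtype
    exact (Set.rangeFactorization_injective.2 hfi).countable
  obtain ⟨e, he⟩ := exists_surjective_nat (ℕ → Bool)
  obtain ⟨k, hk⟩ := he fun n => !(e n n)
  simpa using congrFun hk k

/-- The Lusin–Novikov theorem. -/
theorem isSmall_univ [StandardBorelSpace W] [MeasurableSpace X] [StandardBorelSpace X]
    {π : W → X} (hπ : Measurable π) (hcount : ∀ x, (π ⁻¹' {x}).Countable) : IsSmall π univ := by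
  let := upgradeStandardBorel W
  let := upgradeStandardBorel X
  obtain ⟨t, ht, hc, hp⟩ := hπ.exists_continuous
  have hb : @borel W t = _ := borel_eq_borel_of_le hp
    (@UpgradedStandardBorel.toPolishSpace W _) ht
  have : @BorelSpace W t _ := @BorelSpace.mk W t _ (by rw [hb]; exact BorelSpace.measurable_eq)
  exact @isSmall_univ_of_continuous W X _ _ _ t hp this π hc hcount

end LusinNovikov

section FeldmanMoore

variable {X : Type*} [MeasurableSpace X] [StandardBorelSpace X]

/-- A Borel partial injection with disjoint domain and range extends to a Borel involution. -/
theorem exists_measurable_involutive_of_injOn {D : Set (X × X)} (hD : MeasurableSet D)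
    (h₁ : InjOn Prod.fst D) (h₂ : InjOn Prod.snd D)
    (hd : Disjoint (Prod.fst '' D) (Prod.snd '' D)) :
    ∃ T : X → X, Measurable T ∧ Function.Involutive T ∧ (∀ p ∈ D, T p.1 = p.2) ∧
      ∀ x, T x = x ∨ (x, T x) ∈ D ∨ (T x, x) ∈ D := by
  classical
  let T : X → X := fun x => if h : ∃ y, (x, y) ∈ D then h.choose else
    if h : ∃ y, (y, x) ∈ D then h.choose else x
  have hno : ∀ x y z, (x, y) ∈ D → (z, x) ∈ D → False := fun x y z hy hz =>
    Set.disjoint_left.1 hd ⟨_, hy, rfl⟩ ⟨_, hz, rfl⟩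
  have hT₁ : ∀ x y, (x, y) ∈ D → T x = y := by
    intro x y hxy
    have h : ∃ y, (x, y) ∈ D := ⟨y, hxy⟩
    simp only [T, dif_pos h]
    exact congrArg Prod.snd (h₁ h.choose_spec hxy rfl)
  have hT₂ : ∀ x y, (y, x) ∈ D → T x = y := by
    intro x y hxy
    have h : ∃ y, (y, x) ∈ D := ⟨y, hxy⟩
    have h' : ¬ ∃ y, (x, y) ∈ D := fun ⟨z, hz⟩ => hno x z y hz hxy
    simp only [T, dif_neg h', dif_pos h]
    exact congrArg Prod.fst (h₂ h.choose_spec hxy rfl)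
  have hT₃ : ∀ x, (∀ y, (x, y) ∉ D) → (∀ y, (y, x) ∉ D) → T x = x := by
    intro x h h'
    have h : ¬ ∃ y, (x, y) ∈ D := fun ⟨z, hz⟩ => h z hz
    have h' : ¬ ∃ y, (y, x) ∈ D := fun ⟨z, hz⟩ => h' z hz
    simp only [T, dif_neg h, dif_neg h']
  have hcases : ∀ x, T x = x ∨ (x, T x) ∈ D ∨ (T x, x) ∈ D := by
    intro x
    by_cases h : ∃ y, (x, y) ∈ D
    · obtain ⟨y, hy⟩ := h
      exact .inr (.inl ((hT₁ x y hy).symm ▸ hy))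
    by_cases h' : ∃ y, (y, x) ∈ D
    · obtain ⟨y, hy⟩ := h'
      exact .inr (.inr ((hT₂ x y hy).symm ▸ hy))
    push Not at h h'
    exact .inl (hT₃ x h h')
  refine ⟨T, fun B hB => ?_, fun x => ?_, fun p hp => hT₁ _ _ hp, hcases⟩
  · have e : T ⁻¹' B = Prod.fst '' (D ∩ Prod.snd ⁻¹' B) ∪ Prod.snd '' (D ∩ Prod.fst ⁻¹' B) ∪
        (B \ (Prod.fst '' D ∪ Prod.snd '' D)) := by
      ext x
      constructor
      · intro hx
        rcases hcases x with h | h | h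
        · by_cases hx' : x ∈ Prod.fst '' D ∪ Prod.snd '' D
          · rcases hx' with ⟨⟨a, b⟩, hp, rfl⟩ | ⟨⟨a, b⟩, hp, rfl⟩
            · exact .inl (.inl ⟨_, ⟨hp, by simpa [hT₁ _ _ hp] using hx⟩, rfl⟩)
            · exact .inl (.inr ⟨_, ⟨hp, by simpa [hT₂ _ _ hp] using hx⟩, rfl⟩)
          · exact .inr ⟨by rwa [mem_preimage, h] at hx, hx'⟩
        · exact .inl (.inl ⟨_, ⟨h, hx⟩, rfl⟩)
        · exact .inl (.inr ⟨_, ⟨h, hx⟩, rfl⟩)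
      · rintro ((⟨⟨a, b⟩, ⟨hp, hB⟩, rfl⟩ | ⟨⟨a, b⟩, ⟨hp, hB⟩, rfl⟩) | ⟨hx, hn⟩)
        · simpa [hT₁ _ _ hp] using hB
        · simpa [hT₂ _ _ hp] using hB
        · have : T x = x := hT₃ x (fun y hy => hn (.inl ⟨_, hy, rfl⟩))
            (fun y hy => hn (.inr ⟨_, hy, rfl⟩))
          rwa [mem_preimage, this]
    rw [e]
    refine ((MeasurableSet.image_of_measurable_injOn (hD.inter (measurable_snd hB)) measurable_fst
      (h₁.mono inter_subset_left)).union (MeasurableSet.image_of_measurable_injOn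
      (hD.inter (measurable_fst hB)) measurable_snd (h₂.mono inter_subset_left))).union
      (hB.diff ((hD.image_of_measurable_injOn measurable_fst h₁).union
        (hD.image_of_measurable_injOn measurable_snd h₂)))
  · rcases hcases x with h | h | h
    · rw [h, h]
    · exact hT₂ _ _ h
    · exact hT₁ _ _ h

/-- The Feldman–Moore theorem, with the acting group a free group. -/
theorem exists_freeGroup_action {r : X → X → Prop} (hr : Equivalence r)
    (hm : MeasurableSet {p : X × X | r p.1 p.2}) (hc : ∀ x, {y | r x y}.Countable) :
    ∃ ρ : FreeGroup ℕ →* Equiv.Perm X, (∀ h, Measurable (ρ h)) ∧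
      ∀ x y, r x y ↔ ∃ h, ρ h x = y := by
  let W := {p : X × X // r p.1 p.2}
  have : StandardBorelSpace W := hm.standardBorel
  obtain ⟨C, hC, hCu⟩ := LusinNovikov.isSmall_univ (W := W)
    (measurable_fst.comp measurable_subtype_coe : Measurable fun w : W => w.1.1) (by
      intro x
      refine MapsTo.countable_of_injOn (f := fun w : W => w.1.2) (t := {y | r x y}) ?_ ?_ (hc x)
      · rintro ⟨⟨a, b⟩, hab⟩ rfl
        exact hab
      · rintro ⟨⟨a, b⟩, hab⟩ rfl ⟨⟨a', b'⟩, hab'⟩ h h'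
        exact Subtype.ext (Prod.ext h.symm h'))
  obtain ⟨C', hC', hCu'⟩ := LusinNovikov.isSmall_univ (W := W)
    (measurable_snd.comp measurable_subtype_coe : Measurable fun w : W => w.1.2) (by
      intro x
      refine MapsTo.countable_of_injOn (f := fun w : W => w.1.1) (t := {y | r x y}) ?_ ?_ (hc x)
      · rintro ⟨⟨a, b⟩, hab⟩ rfl
        exact hr.symm hab
      · rintro ⟨⟨a, b⟩, hab⟩ rfl ⟨⟨a', b'⟩, hab'⟩ h h'
        exact Subtype.ext (Prod.ext h' h.symm))
  obtain ⟨s, hs, hsi⟩ := MeasurableSpace.measurable_injection_nat_bool_of_countablySeparated X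
  have hs' : ∀ k, Measurable fun x => s x k := fun k => (measurable_pi_apply k).comp hs
  let D : ℕ × ℕ × ℕ → Set (X × X) := fun i => Subtype.val '' (C i.1 ∩ C' i.2.1) ∩
    {p | s p.1 i.2.2 = true ∧ s p.2 i.2.2 = false}
  have hDm : ∀ i, MeasurableSet (D i) := fun i =>
    (hm.subtype_image ((hC i.1).1.inter (hC' i.2.1).1)).inter
      (((hs' _).comp measurable_fst (measurableSet_singleton true)).inter
        ((hs' _).comp measurable_snd (measurableSet_singleton false)))
  have hex := fun i => exists_measurable_involutive_of_injOn (hDm i)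
    (by
      rintro _ ⟨⟨w, hw, rfl⟩, -⟩ _ ⟨⟨w', hw', rfl⟩, -⟩ h
      exact congrArg Subtype.val ((hC i.1).2 hw.1 hw'.1 h))
    (by
      rintro _ ⟨⟨w, hw, rfl⟩, -⟩ _ ⟨⟨w', hw', rfl⟩, -⟩ h
      exact congrArg Subtype.val ((hC' i.2.1).2 hw.2 hw'.2 h))
    (by
      rw [Set.disjoint_left]
      rintro _ ⟨p, ⟨-, hp⟩, rfl⟩ ⟨q, ⟨-, hq⟩, h⟩
      have := hq.2
      rw [h, hp.1] at this
      cases this)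
  choose T hTm hTi hTD hTc using hex
  have hTr : ∀ i x, r x (T i x) := by
    intro i x
    rcases hTc i x with h | h | h
    · rw [h]; exact hr.refl x
    · obtain ⟨⟨w, -, hw⟩, -⟩ := h
      have := w.2
      rw [hw] at this
      exact this
    · obtain ⟨⟨w, -, hw⟩, -⟩ := h
      have := w.2
      rw [hw] at this
      exact hr.symm this
  obtain ⟨e⟩ : Nonempty (ℕ ≃ ℕ × ℕ × ℕ) := ⟨(Denumerable.eqv _).symm⟩
  have hlift : ∀ n, FreeGroup.lift (fun n => (hTi (e n)).toPerm) (.of n) = (hTi (e n)).toPerm :=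
    fun n => FreeGroup.lift_apply_of
  refine ⟨FreeGroup.lift fun n => (hTi (e n)).toPerm, fun h => ?_, fun x y => ⟨fun hxy => ?_, ?_⟩⟩
  · induction h using FreeGroup.induction_on with
    | C1 => rw [map_one]; exact measurable_id
    | of n => rw [hlift]; exact hTm (e n)
    | inv_of n _ => rw [map_inv, hlift]; exact hTm (e n)
    | mul a b ha hb => rw [map_mul]; exact ha.comp hb
  · have key : ∀ x y k, r x y → s x k = true → s y k = false → ∃ i, T i x = y := by
      intro x y k hxy hx hy
      have h₁ : (⟨(x, y), hxy⟩ : W) ∈ ⋃ n, C n := hCu ▸ mem_univ _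
      have h₂ : (⟨(x, y), hxy⟩ : W) ∈ ⋃ n, C' n := hCu' ▸ mem_univ _
      obtain ⟨a, ha⟩ := mem_iUnion.1 h₁
      obtain ⟨b, hb⟩ := mem_iUnion.1 h₂
      exact ⟨(a, b, k), hTD (a, b, k) (x, y) ⟨⟨_, ⟨ha, hb⟩, rfl⟩, hx, hy⟩⟩
    by_cases hxy' : x = y
    · exact ⟨1, by simpa using hxy'⟩
    obtain ⟨k, hk⟩ := Function.ne_iff.1 fun h => hxy' (hsi h)
    obtain ⟨i, hi⟩ : ∃ i, T i x = y := by
      cases hx : s x k with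
      | true => exact key x y k hxy hx (by rw [hx] at hk; simpa using hk.symm)
      | false =>
        obtain ⟨i, hi⟩ := key y x k (hr.symm hxy) (by rw [hx] at hk; simpa using hk.symm) hx
        exact ⟨i, by rw [← hi, hTi]⟩
    refine ⟨.of (e.symm i), ?_⟩
    rw [hlift]
    simpa using hi
  · rintro ⟨h, rfl⟩
    induction h using FreeGroup.induction_on generalizing x with
    | C1 => rw [map_one]; exact hr.refl x
    | of n => rw [hlift]; exact hTr (e n) x
    | inv_of n _ => rw [map_inv, hlift]; exact hTr (e n) x
    | mul a b ha hb => rw [map_mul]; exact hr.trans (hb x) (ha _)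

end FeldmanMoore

end

section

open Set
open scoped commutatorElement

namespace FreeGroup

variable {ι : Type*}

/-- The subgroup generated by the letters in `T`. -/
def supported (T : Set ι) : Subgroup (FreeGroup ι) := Subgroup.closure (of '' T)

theorem of_mem_supported {T : Set ι} {a : ι} (ha : a ∈ T) : of a ∈ supported T :=
  Subgroup.subset_closure (mem_image_of_mem _ ha)

theorem supported_mono {S T : Set ι} (h : S ⊆ T) : supported S ≤ supported T :=
  Subgroup.closure_mono (image_mono h)

open Classical in
theorem mem_supported_iff {T : Set ι} {f : FreeGroup ι} :
    f ∈ supported T ↔ ∀ x ∈ f.toWord, x.1 ∈ T := by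
  constructor
  · intro hf
    induction hf using Subgroup.closure_induction with
    | mem x hx =>
      obtain ⟨a, ha, rfl⟩ := hx
      simpa using ha
    | one => simp
    | mul x y _ _ hx hy =>
      intro z hz
      rcases List.mem_append.1 ((toWord_mul_sublist x y).subset hz) with h | h
      · exact hx z h
      · exact hy z h
    | inv x _ hx =>
      intro z hz
      rw [toWord_inv] at hz
      simp only [invRev, List.mem_reverse, List.mem_map] at hz
      obtain ⟨y, hy, rfl⟩ := hz
      exact hx y hy
  · intro h
    rw [← mk_toWord (x := f)]
    generalize f.toWord = l at h
    induction l with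
    | nil => exact one_mem _
    | cons x l ih =>
      have e : mk (x :: l) = mk [x] * mk l := by simp [mul_mk]
      rw [e]
      refine mul_mem ?_ (ih fun y hy => h y (List.mem_cons_of_mem _ hy))
      have hx := of_mem_supported (h x List.mem_cons_self)
      rcases x with ⟨a, _ | _⟩
      · exact inv_mem hx
      · exact hx

theorem supported_inf (S T : Set ι) : supported S ⊓ supported T = supported (S ∩ T) := by
  ext f
  simp only [Subgroup.mem_inf, mem_supported_iff]
  exact ⟨fun h x hx => ⟨h.1 x hx, h.2 x hx⟩,
    fun h => ⟨fun x hx => (h x hx).1, fun x hx => (h x hx).2⟩⟩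

theorem exists_finite_mem_supported (f : FreeGroup ι) :
    ∃ T : Set ι, T.Finite ∧ f ∈ supported T := by
  classical
  exact ⟨{a | a ∈ f.toWord.map Prod.fst}, List.finite_toSet _,
    mem_supported_iff.2 fun x hx => List.mem_map_of_mem hx⟩

theorem lift_congr_of_mem_supported {G : Type*} [Group G] {T : Set ι} {c d : FreeGroup ι →* G}
    (h : ∀ a ∈ T, c (of a) = d (of a)) {f : FreeGroup ι} (hf : f ∈ supported T) : c f = d f :=
  MonoidHom.eqOn_closure (s := of '' T) (by rintro _ ⟨a, ha, rfl⟩; exact h a ha) hf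

open Classical in
/-- The retraction onto the letters in `T`. -/
noncomputable def retract (T : Set ι) : FreeGroup ι →* FreeGroup ι :=
  lift fun a => if a ∈ T then of a else 1

theorem retract_of_mem {T : Set ι} {f : FreeGroup ι} (hf : f ∈ supported T) : retract T f = f :=
  lift_congr_of_mem_supported (d := MonoidHom.id _) (fun a ha => by simp [retract, ha]) hf

theorem retract_of_mem_compl {T : Set ι} {f : FreeGroup ι} (hf : f ∈ supported Tᶜ) :
    retract T f = 1 :=
  lift_congr_of_mem_supported (d := 1) (fun a ha => by
    have : a ∉ T := ha
    simp [retract, this]) hf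

theorem mem_of_mem_sup {T : Set ι} {A B : Subgroup (FreeGroup ι)} (hA : A ≤ supported T)
    (hB : B ≤ supported Tᶜ) {f : FreeGroup ι} (hf : f ∈ A ⊔ B) (hfT : f ∈ supported T) : f ∈ A := by
  rw [← retract_of_mem hfT]
  have : A ⊔ B ≤ A.comap (retract T) := sup_le
    (fun a ha => by rwa [Subgroup.mem_comap, retract_of_mem (hA ha)])
    (fun b hb => by rw [Subgroup.mem_comap, retract_of_mem_compl (hB hb)]; exact one_mem _)
  exact this hf

theorem eq_of_mul_of_mul_eq {p : ι} {b b' d d' : FreeGroup ι} (hb : b ∈ supported {p}ᶜ)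
    (hb' : b' ∈ supported {p}ᶜ) (hd : d ∈ supported {p}ᶜ) (hd' : d' ∈ supported {p}ᶜ)
    (h : b * of p * d = b' * of p * d') : b = b' := by
  classical
  have hk : (b'⁻¹ * b) * of p * (d * d'⁻¹) = of p := by
    calc _ = b'⁻¹ * (b * of p * d) * d'⁻¹ := by group
      _ = of p := by rw [h]; group
  have hb₁ : b'⁻¹ * b ∈ supported {p}ᶜ := mul_mem (inv_mem hb') hb
  have hd₁ : d * d'⁻¹ ∈ supported {p}ᶜ := mul_mem hd (inv_mem hd')
  generalize d * d'⁻¹ = e at hk hd₁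
  suffices H : b'⁻¹ * b = 1 by rwa [inv_mul_eq_one, eq_comm] at H
  generalize b'⁻¹ * b = k at hk hb₁
  have h₁ : k * e = 1 := by
    have := congrArg (retract {p}ᶜ) hk
    rw [_root_.map_mul, _root_.map_mul, retract_of_mem hb₁, retract_of_mem hd₁,
      retract_of_mem_compl (by rw [compl_compl]; exact of_mem_supported rfl)] at this
    simpa using this
  obtain rfl : e = k⁻¹ := eq_inv_of_mul_eq_one_right h₁
  have h₂ : k * of p = of p * k := mul_inv_eq_iff_eq_mul.1 hk
  have hk' : ∀ x ∈ k.toWord, x.1 ≠ p := mem_supported_iff.1 hb₁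
  have w₁ : (k * of p).toWord = k.toWord ++ [(p, true)] := by
    have : k * of p = mk (k.toWord ++ [(p, true)]) := by rw [← mul_mk, mk_toWord]; rfl
    rw [this, toWord_mk]
    refine IsReduced.reduce_eq (List.isChain_append.2 ⟨isReduced_toWord, by simp, ?_⟩)
    intro x hx y hy hxy
    obtain rfl : (p, true) = y := by simpa using hy
    exact absurd hxy (hk' x (List.mem_of_mem_getLast? hx))
  have w₂ : (of p * k).toWord = (p, true) :: k.toWord := by
    have : of p * k = mk ([(p, true)] ++ k.toWord) := by rw [← mul_mk, mk_toWord]; rfl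
    rw [this, toWord_mk]
    refine IsReduced.reduce_eq (List.isChain_append.2 ⟨by simp, isReduced_toWord, ?_⟩)
    intro x hx y hy hxy
    obtain rfl : (p, true) = x := by simpa using hx
    exact absurd hxy.symm (hk' y (List.mem_of_mem_head? hy))
  rw [← toWord_eq_nil_iff]
  rw [h₂, w₂] at w₁
  cases hw : k.toWord with
  | nil => rfl
  | cons x l =>
    rw [hw, List.cons_append, List.cons.injEq] at w₁
    exact absurd (congrArg Prod.fst w₁.1).symm (hk' x (by rw [hw]; exact List.mem_cons_self))

open Classical in
/-- The endomorphism sending the letter `p` to `p * q`. -/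
noncomputable def transvection (p q : ι) : FreeGroup ι →* FreeGroup ι :=
  lift fun a => if a = p then of p * of q else of a

theorem transvection_of_mem {p q : ι} {f : FreeGroup ι} (hf : f ∈ supported {p}ᶜ) :
    transvection p q f = f :=
  lift_congr_of_mem_supported (d := MonoidHom.id _) (fun a ha => by
    have : a ≠ p := ha
    simp [transvection, this]) hf

theorem transvection_of (p q : ι) : transvection p q (of p) = of p * of q := by
  simp [transvection]

open Classical in
/-- The spelling of the image of a letter under `transvection p q`. -/
noncomputable def transvectionWord (p q : ι) (x : ι × Bool) : List (ι × Bool) :=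
  if x = (p, true) then [(p, true), (q, true)] else
    if x = (p, false) then [(q, false), (p, false)] else [x]

theorem transvection_mk (p q : ι) (l : List (ι × Bool)) :
    transvection p q (mk l) = mk (l.flatMap (transvectionWord p q)) := by
  induction l with
  | nil => exact _root_.map_one _
  | cons x l ih =>
    have e : mk (x :: l) = mk [x] * mk l := by simp [mul_mk]
    rw [e, _root_.map_mul, ih, List.flatMap_cons, ← mul_mk]
    congr 1
    rcases x with ⟨a, _ | _⟩
    · have : mk [(a, false)] = (of a)⁻¹ := rfl
      rw [this, _root_.map_inv]
      by_cases h : a = p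
      · subst h
        simp only [transvection_of, transvectionWord]
        simp
        rfl
      · simp [transvection, transvectionWord, h]
        rfl
    · have : mk [(a, true)] = of a := rfl
      rw [this]
      by_cases h : a = p
      · subst h
        simp only [transvection_of, transvectionWord]
        simp
        rfl
      · simp [transvection, transvectionWord, h]
        rfl

theorem isReduced_flatMap_transvectionWord {p q : ι} (hpq : p ≠ q) {l : List (ι × Bool)}
    (hl : IsReduced l) (hq : ∀ x ∈ l, x.1 ≠ q) :
    IsReduced (l.flatMap (transvectionWord p q)) := by
  induction l with
  | nil => simp
  | cons x l ih =>
    have ih := ih (List.IsChain.tail hl) fun y hy => hq y (List.mem_cons_of_mem _ hy)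
    rw [List.flatMap_cons]
    refine List.isChain_append.2 ⟨?_, ih, ?_⟩
    · simp only [transvectionWord]
      split_ifs <;> simp [hpq, hpq.symm]
    · cases l with
      | nil => simp
      | cons y l =>
        have hxy : x.1 = y.1 → x.2 = y.2 := (List.isChain_cons_cons.1 hl).1
        have hxq := hq x List.mem_cons_self
        have hyq := hq y (List.mem_cons_of_mem _ List.mem_cons_self)
        rw [List.flatMap_cons]
        simp only [transvectionWord]
        rcases x with ⟨a, s⟩
        rcases y with ⟨b, t⟩
        by_cases ha : a = p <;> by_cases hb : b = p <;> cases s <;> cases t <;>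
          simp_all <;> exact Ne.symm hyq

theorem eq_or_split_of_flatMap_eq {p q : ι} (hpq : p ≠ q) {l l₁ l₂ : List (ι × Bool)}
    (h : l.flatMap (transvectionWord p q) = l₁ ++ l₂) (h₁ : ∀ x ∈ l₁, x.1 ≠ q)
    (h₂ : ∀ x ∈ l₂, x.1 ≠ p) (hq : ∀ x ∈ l, x.1 ≠ q) :
    (∀ x ∈ l, x.1 ≠ p) ∨ ∃ b d, l = b ++ (p, true) :: d ∧ (∀ x ∈ b, x.1 ≠ p) ∧
      ∀ x ∈ d, x.1 ≠ p := by
  have key : ∀ l : List (ι × Bool), (∀ x ∈ l.flatMap (transvectionWord p q), x.1 ≠ p) →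
      ∀ x ∈ l, x.1 ≠ p := by
    rintro l hl ⟨a, s⟩ hx rfl
    cases s
    · exact hl (a, false) (List.mem_flatMap.2 ⟨_, hx, by simp [transvectionWord]⟩) rfl
    · exact hl (a, true) (List.mem_flatMap.2 ⟨_, hx, by simp [transvectionWord]⟩) rfl
  induction l generalizing l₁ with
  | nil => simp
  | cons x l ih =>
    cases l₁ with
    | nil =>
      rw [List.nil_append] at h
      exact .inl (key _ (h ▸ h₂))
    | cons y l₁ =>
      have hq' : ∀ x ∈ l, x.1 ≠ q := fun z hz => hq z (List.mem_cons_of_mem _ hz)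
      have h₁' : ∀ x ∈ l₁, x.1 ≠ q := fun z hz => h₁ z (List.mem_cons_of_mem _ hz)
      have hy := h₁ y List.mem_cons_self
      rw [List.flatMap_cons] at h
      by_cases hx : x = (p, true)
      · subst hx
        simp only [transvectionWord, if_true, List.cons_append, List.nil_append,
          List.cons.injEq] at h
        obtain ⟨rfl, h⟩ := h
        refine .inr ⟨[], l, rfl, by simp, ?_⟩
        cases l₁ with
        | nil =>
          rw [List.nil_append] at h
          exact key _ fun z hz => h₂ z (h ▸ List.mem_cons_of_mem _ hz)
        | cons y l₁ =>
          rw [List.cons_append, List.cons.injEq] at h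
          exact absurd (congrArg Prod.fst h.1).symm (h₁' y List.mem_cons_self)
      · by_cases hx' : x = (p, false)
        · subst hx'
          simp [transvectionWord] at h
          exact absurd (congrArg Prod.fst h.1).symm hy
        · simp only [transvectionWord, hx, hx', if_false, List.cons_append, List.nil_append,
            List.cons.injEq] at h
          obtain ⟨rfl, h⟩ := h
          have hxp : x.1 ≠ p := by
            rintro rfl
            rcases x with ⟨a, _ | _⟩
            · exact hx' rfl
            · exact hx rfl
          rcases ih h h₁' hq' with h | ⟨b, d, rfl, hb, hd⟩
          · exact .inl (List.forall_mem_cons.2 ⟨hxp, h⟩)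
          · exact .inr ⟨x :: b, d, rfl, List.forall_mem_cons.2 ⟨hxp, hb⟩, hd⟩

/-- If `w(pq) = u(p) v(q)`, then the letter `p` occurs in `w` at most once. -/
theorem mem_supported_or_eq_of_transvection_eq {p q : ι} (hpq : p ≠ q) {w u v : FreeGroup ι}
    (hw : w ∈ supported {q}ᶜ) (hu : u ∈ supported {q}ᶜ) (hv : v ∈ supported {p}ᶜ)
    (h : transvection p q w = u * v) :
    w ∈ supported ({p}ᶜ ∩ {q}ᶜ) ∨ ∃ b ∈ supported ({p}ᶜ ∩ {q}ᶜ), ∃ d ∈ supported ({p}ᶜ ∩ {q}ᶜ),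
      w = b * of p * d := by
  classical
  have hw' : ∀ x ∈ w.toWord, x.1 ≠ q := mem_supported_iff.1 hw
  have e : (u * v).toWord = w.toWord.flatMap (transvectionWord p q) := by
    rw [← h]
    conv_lhs => rw [← mk_toWord (x := w), transvection_mk, toWord_mk]
    exact (isReduced_flatMap_transvectionWord hpq isReduced_toWord hw').reduce_eq
  obtain ⟨l₁, l₂, hl, hl₁, hl₂⟩ := List.sublist_append_iff.1 (toWord_mul_sublist u v)
  rw [e] at hl
  rcases eq_or_split_of_flatMap_eq hpq hl (fun x hx => mem_supported_iff.1 hu x (hl₁.subset hx))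
    (fun x hx => mem_supported_iff.1 hv x (hl₂.subset hx)) hw' with h | ⟨b, d, hbd, hb, hd⟩
  · exact .inl (mem_supported_iff.2 fun x hx => ⟨h x hx, hw' x hx⟩)
  · have hr : IsReduced (b ++ (p, true) :: d) := hbd ▸ isReduced_toWord
    have hrb : IsReduced b := (List.isChain_append.1 hr).1
    have hrd : IsReduced d := (List.isChain_append.1 hr).2.1.tail
    rw [hbd] at hw'
    refine .inr ⟨mk b, mem_supported_iff.2 fun x hx => ?_, mk d,
      mem_supported_iff.2 fun x hx => ?_, ?_⟩
    · rw [toWord_mk, hrb.reduce_eq] at hx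
      exact ⟨hb x hx, hw' x (List.mem_append_left _ hx)⟩
    · rw [toWord_mk, hrd.reduce_eq] at hx
      exact ⟨hd x hx, hw' x (List.mem_append_right _ (List.mem_cons_of_mem _ hx))⟩
    · rw [← mk_toWord (x := w), hbd]
      have : of p = mk [(p, true)] := rfl
      rw [this, mul_mk, mul_mk]
      simp

end FreeGroup

namespace FreeGroup

variable {ι : Type*}

theorem zpowers_le_supported {T : Set ι} {z : FreeGroup ι} (hz : z ∈ supported T) :
    Subgroup.zpowers z ≤ supported T := Subgroup.zpowers_le.2 hz

theorem eq_one_of_mem_supported_compl {T : Set ι} {f : FreeGroup ι} (h : f ∈ supported T)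
    (h' : f ∈ supported Tᶜ) : f = 1 := by
  rw [← retract_of_mem h, retract_of_mem_compl h']

theorem of_mul_of_ne {p q : ι} (hpq : p ≠ q) : of p * of q ≠ of q * of p := by
  intro h
  have := eq_of_mul_of_mul_eq (p := p) (b := 1) (d := of q) (b' := of q) (d' := 1) (one_mem _)
    (of_mem_supported hpq.symm) (of_mem_supported hpq.symm) (one_mem _) (by simpa using h)
  exact of_ne_one q this.symm

theorem exists_eq_mul_of_mul {p q : ι} (hpq : p ≠ q) {A : Subgroup (FreeGroup ι)}
    (hA : A ≤ supported ({p}ᶜ ∩ {q}ᶜ)) {u v : FreeGroup ι}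
    (hu : u ∈ A ⊔ Subgroup.zpowers (of p)) (hv : v ∈ A ⊔ Subgroup.zpowers (of q))
    (huv : u * v ∈ A ⊔ Subgroup.zpowers (of p * of q)) (hvA : v ∉ A) :
    ∃ b ∈ supported ({p}ᶜ ∩ {q}ᶜ), ∃ k ∈ supported ({p}ᶜ ∩ {q}ᶜ),
      ∃ d ∈ supported ({p}ᶜ ∩ {q}ᶜ), u = b * of p * k⁻¹ ∧ v = k * of q * d := by
  have hAp : A ≤ supported {p}ᶜ := hA.trans (supported_mono inter_subset_left)
  have hAq : A ≤ supported {q}ᶜ := hA.trans (supported_mono inter_subset_right)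
  have hle : A ⊔ Subgroup.zpowers (of p) ≤ supported {q}ᶜ :=
    sup_le hAq (zpowers_le_supported (of_mem_supported hpq))
  have hle' : A ⊔ Subgroup.zpowers (of q) ≤ supported {p}ᶜ :=
    sup_le hAp (zpowers_le_supported (of_mem_supported hpq.symm))
  have hmap : A ⊔ Subgroup.zpowers (of p * of q) ≤
      (A ⊔ Subgroup.zpowers (of p)).map (transvection p q) :=
    sup_le (fun a ha => ⟨a, le_sup_left (a := A) ha, transvection_of_mem (hAp ha)⟩)
      (Subgroup.zpowers_le.2 ⟨of p, le_sup_right (a := A) (Subgroup.mem_zpowers _),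
        transvection_of p q⟩)
  obtain ⟨w, hw, hwuv⟩ := hmap huv
  rcases mem_supported_or_eq_of_transvection_eq hpq (hle hw) (hle hu) (hle' hv) hwuv with
    h | ⟨b, hb, d, hd, rfl⟩
  · rw [← supported_inf] at h
    rw [transvection_of_mem h.1] at hwuv
    have hvq : v ∈ supported {q}ᶜ := by
      have : v = u⁻¹ * w := by rw [hwuv]; group
      rw [this]
      exact mul_mem (inv_mem (hle hu)) h.2
    refine absurd (mem_of_mem_sup hAq ?_ hv hvq) hvA
    exact zpowers_le_supported (of_mem_supported (by simp))
  · rw [← supported_inf] at hb hd ⊢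
    rw [_root_.map_mul, _root_.map_mul, transvection_of, transvection_of_mem hb.1,
      transvection_of_mem hd.1] at hwuv
    have e : u⁻¹ * b * of p = v * d⁻¹ * (of q)⁻¹ := by
      have : v = u⁻¹ * (b * (of p * of q) * d) := by rw [hwuv]; group
      rw [this]; group
    refine ⟨b, hb, u⁻¹ * b * of p, Subgroup.mem_inf.2 ⟨?_, ?_⟩, d, hd, by group, ?_⟩
    · rw [e]
      exact mul_mem (mul_mem (hle' hv) (inv_mem hd.1))
        (inv_mem (of_mem_supported (Ne.symm hpq)))
    · exact mul_mem (mul_mem (inv_mem (hle hu)) hb.2) (of_mem_supported hpq)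
    · rw [e]; group

section Separation

variable {G : Type*} [Group G] (φ c : FreeGroup ι →* G) (e : ℕ → ι)

/-- The homomorphism `c` cannot match two subgroups lying between `L ⊓ N₀` and `L ⊓ N₁`. -/
def Separates (N₀ N₁ L : Subgroup (FreeGroup ι)) : Prop :=
  (∃ f ∈ L ⊓ N₀, ∀ f' ∈ L ⊓ N₁, c f ≠ φ f') ∨ ∃ f ∈ L ⊓ N₀, ∀ f' ∈ L ⊓ N₁, φ f ≠ c f'

/-- On almost all letters `e m`, the homomorphism `c` is `φ` composed with an inner
automorphism. -/
def IsEventuallyInner : Prop :=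
  ∃ b M, ∀ m ≥ M, c (of (e m)) = φ (b * of (e m) * b⁻¹)

variable {φ c e}

theorem exists_mem_supported_compl_tail (he : e.Injective) (f : FreeGroup ι) (M₀ : ℕ) :
    ∃ M ≥ M₀, f ∈ supported (e '' Ici M)ᶜ := by
  obtain ⟨T, hT, hf⟩ := exists_finite_mem_supported f
  obtain ⟨B, hB⟩ := (hT.preimage he.injOn).bddAbove
  refine ⟨max M₀ (B + 1), le_max_left _ _, supported_mono ?_ hf⟩
  rintro _ ha ⟨m, hm, rfl⟩
  have h₁ := hB (show m ∈ e ⁻¹' T from ha)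
  have h₂ := le_max_right M₀ (B + 1)
  have h₃ : max M₀ (B + 1) ≤ m := hm
  omega

theorem isEventuallyInner_of_forall_mem (hφ : Function.Injective φ) (he : e.Injective)
    {A : Subgroup (FreeGroup ι)} {M : ℕ} (hA : A ≤ supported (e '' Ici M)ᶜ) {χ : ℕ → FreeGroup ι}
    (hχ : ∀ m ≥ M, c (of (e m)) = φ (χ m)) (hχA : ∀ m ≥ M, χ m ∉ A)
    (hc : ∀ z ∈ supported (e '' Ici M), ∃ z' ∈ A ⊔ Subgroup.zpowers z, c z = φ z') :
    IsEventuallyInner φ c e := by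
  have hmem : ∀ m ≥ M, χ m ∈ A ⊔ Subgroup.zpowers (of (e m)) := by
    intro m hm
    obtain ⟨z', hz', h⟩ := hc _ (of_mem_supported (mem_image_of_mem _ hm))
    rw [hχ m hm] at h
    rwa [hφ h]
  have hpair : ∀ m ≥ M, ∀ l ≥ M, m ≠ l → ∃ b ∈ supported ({e m}ᶜ ∩ {e l}ᶜ),
      ∃ k ∈ supported ({e m}ᶜ ∩ {e l}ᶜ), ∃ d ∈ supported ({e m}ᶜ ∩ {e l}ᶜ),
      χ m = b * of (e m) * k⁻¹ ∧ χ l = k * of (e l) * d := by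
    intro m hm l hl hml
    refine exists_eq_mul_of_mul (he.ne hml) (hA.trans (supported_mono ?_)) (hmem m hm) (hmem l hl)
      ?_ (hχA l hl)
    · intro a ha
      refine ⟨?_, ?_⟩
      · rintro rfl
        exact ha (mem_image_of_mem _ hm)
      · rintro rfl
        exact ha (mem_image_of_mem _ hl)
    · obtain ⟨z', hz', h⟩ := hc (of (e m) * of (e l))
        (mul_mem (of_mem_supported (mem_image_of_mem _ hm))
          (of_mem_supported (mem_image_of_mem _ hl)))
      rw [_root_.map_mul, hχ m hm, hχ l hl, ← _root_.map_mul] at h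
      rwa [hφ h]
  have hrep : ∀ m ≥ M, ∃ b d, b ∈ supported {e m}ᶜ ∧ d ∈ supported {e m}ᶜ ∧
      χ m = b * of (e m) * d⁻¹ := by
    intro m hm
    obtain ⟨b, hb, k, hk, -, -, h, -⟩ := hpair m hm (m + 1) (by omega) (by omega)
    rw [← supported_inf] at hb hk
    exact ⟨b, k, hb.1, hk.1, h⟩
  have : ∀ m, ∃ b d, m ≥ M → b ∈ supported {e m}ᶜ ∧ d ∈ supported {e m}ᶜ ∧
      χ m = b * of (e m) * d⁻¹ := by
    intro m
    by_cases hm : m ≥ M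
    · obtain ⟨b, d, h⟩ := hrep m hm
      exact ⟨b, d, fun _ => h⟩
    · exact ⟨1, 1, fun h => absurd h hm⟩
  choose b d hbd using this
  have hdb : ∀ m ≥ M, ∀ l ≥ M, m ≠ l → d m = b l := by
    intro m hm l hl hml
    obtain ⟨b', hb', k, hk, d', hd', h₁, h₂⟩ := hpair m hm l hl hml
    rw [← supported_inf] at hb' hk hd'
    obtain ⟨hbm, hdm, em⟩ := hbd m hm
    obtain ⟨hbl, hdl, el⟩ := hbd l hl
    have e₁ : b l = k := eq_of_mul_of_mul_eq hbl hk.2 (inv_mem hdl) hd'.2 (el.symm.trans h₂)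
    have e₂ : b m = b' := eq_of_mul_of_mul_eq hbm hb'.1 (inv_mem hdm) (inv_mem hk.1)
      (em.symm.trans h₁)
    rw [em, e₂] at h₁
    rw [e₁]
    exact inv_injective (mul_left_cancel h₁)
  have hb : ∀ m ≥ M, b m = b M ∧ d m = b M := by
    intro m hm
    have hM2 := hdb (m + M + 1) (by omega) M le_rfl (by omega)
    have hm2 := hdb (m + M + 1) (by omega) m hm (by omega)
    have h₁ : b m = b M := hm2.symm.trans hM2
    have h₂ := hdb m hm (m + M + 1) (by omega) (by omega)
    have h₃ := hdb (m + M + 2) (by omega) (m + M + 1) (by omega) (by omega)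
    have h₄ := hdb (m + M + 2) (by omega) M (by omega) (by omega)
    exact ⟨h₁, h₂.trans (h₃.symm.trans h₄)⟩
  refine ⟨b M, M, fun m hm => ?_⟩
  rw [hχ m hm, (hbd m hm).2.2, (hb m hm).1, (hb m hm).2]

/-- Any embedding `c` is either inner on almost all letters, or can be separated from `φ` by
adding one word in the remaining letters. -/
theorem exists_separates_or_isEventuallyInner (hφ : Function.Injective φ)
    (hc : Function.Injective c) (he : e.Injective) {N₀ N₁ : Subgroup (FreeGroup ι)}
    (hcomm : ∀ x ∈ N₁, ∀ y ∈ N₁, ⁅x, y⁆ ∈ N₀) (heN : ∀ m, of (e m) ∈ N₀)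
    {A : Subgroup (FreeGroup ι)} {M : ℕ} (hA : A ≤ supported (e '' Ici M)ᶜ) :
    IsEventuallyInner φ c e ∨ ∃ M' ≥ M, ∃ z ∈ supported (e '' Ici M), z ∈ supported (e '' Ici M')ᶜ ∧
      ∀ Q ≤ supported (e '' Ici M'), Separates φ c N₀ N₁ (A ⊔ Subgroup.zpowers z ⊔ Q) := by
  have htail : ∀ {M M' : ℕ}, M ≤ M' → supported (e '' Ici M)ᶜ ≤ supported (e '' Ici M')ᶜ :=
    fun h => supported_mono (compl_subset_compl.2 (image_mono (Ici_subset_Ici.2 h)))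
  have hfresh : ∀ z ∈ supported (e '' Ici M), z ∈ N₀ := fun z hz =>
    (Subgroup.closure_le _).2 (by rintro _ ⟨_, ⟨m, -, rfl⟩, rfl⟩; exact heN m) hz
  have hin : ∀ {M' : ℕ} {z f : FreeGroup ι} {Q : Subgroup (FreeGroup ι)}, M ≤ M' →
      z ∈ supported (e '' Ici M')ᶜ → Q ≤ supported (e '' Ici M') →
      f ∈ supported (e '' Ici M')ᶜ → f ∈ A ⊔ Subgroup.zpowers z ⊔ Q →
      f ∈ A ⊔ Subgroup.zpowers z := fun hM hz hQ hf h =>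
    mem_of_mem_sup (sup_le (hA.trans (htail hM)) (zpowers_le_supported hz))
      (by rwa [compl_compl]) h hf
  have hzL : ∀ (z : FreeGroup ι) (Q : Subgroup (FreeGroup ι)),
      z ∈ A ⊔ Subgroup.zpowers z ⊔ Q := fun z Q =>
    le_sup_left (a := A ⊔ _) (le_sup_right (a := A) (Subgroup.mem_zpowers z))
  by_cases h₁ : ∃ z ∈ supported (e '' Ici M), ∀ z' ∈ A ⊔ Subgroup.zpowers z, z' ∈ N₁ → c z ≠ φ z'
  · obtain ⟨z, hz, hcz⟩ := h₁
    right
    obtain ⟨M₁, hM₁, hzM₁⟩ := exists_mem_supported_compl_tail he z M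
    by_cases hr : ∃ z', φ z' = c z
    · obtain ⟨z', hz'⟩ := hr
      obtain ⟨M₂, hM₂, hzM₂⟩ := exists_mem_supported_compl_tail he z' M₁
      refine ⟨M₂, hM₁.trans hM₂, z, hz, htail hM₂ hzM₁, fun Q hQ =>
        .inl ⟨z, ⟨hzL z Q, hfresh z hz⟩, fun f' hf' h => ?_⟩⟩
      rw [← hz'] at h
      obtain rfl := hφ h
      exact hcz _ (hin (hM₁.trans hM₂) (htail hM₂ hzM₁) hQ hzM₂ hf'.1) hf'.2 hz'.symm
    · push Not at hr
      exact ⟨M₁, hM₁, z, hz, hzM₁, fun Q hQ =>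
        .inl ⟨z, ⟨hzL z Q, hfresh z hz⟩, fun f' _ h => hr f' h.symm⟩⟩
  push Not at h₁
  have hex : ∀ m, ∃ x, m ≥ M → x ∈ N₁ ∧ c (of (e m)) = φ x := by
    intro m
    by_cases hm : m ≥ M
    · obtain ⟨x, -, hx⟩ := h₁ _ (of_mem_supported (mem_image_of_mem _ hm))
      exact ⟨x, fun _ => hx⟩
    · exact ⟨1, fun h => absurd h hm⟩
  choose χ hχ using hex
  by_cases h₂ : ∃ m ≥ M, ∃ l ≥ M, m ≠ l ∧ χ m ∈ A ∧ χ l ∈ A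
  · obtain ⟨m, hm, l, hl, hml, hmA, hlA⟩ := h₂
    right
    obtain ⟨M₁, hM₁, hzM₁⟩ := exists_mem_supported_compl_tail he ⁅of (e m), of (e l)⁆ M
    refine ⟨M₁, hM₁, 1, one_mem _, one_mem _, fun Q hQ => .inr ⟨⁅χ m, χ l⁆,
      ⟨le_sup_left (a := A ⊔ _) (le_sup_left (a := A) (mul_mem (mul_mem (mul_mem hmA hlA)
        (inv_mem hmA)) (inv_mem hlA))), hcomm _ (hχ m hm).1 _ (hχ l hl).1⟩,
      fun f' hf' h => ?_⟩⟩
    rw [map_commutatorElement, ← (hχ m hm).2, ← (hχ l hl).2, ← map_commutatorElement] at h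
    obtain rfl := hc h
    have h₃ := hin hM₁ (one_mem _) hQ hzM₁ hf'.1
    rw [Subgroup.zpowers_one_eq_bot, sup_bot_eq] at h₃
    have hs : ∀ i ≥ M, of (e i) ∈ supported (e '' Ici M) := fun i hi =>
      of_mem_supported (mem_image_of_mem _ hi)
    have h₄ := eq_one_of_mem_supported_compl (T := e '' Ici M)
      (mul_mem (mul_mem (mul_mem (hs m hm) (hs l hl)) (inv_mem (hs m hm))) (inv_mem (hs l hl)))
      (hA h₃)
    exact of_mul_of_ne (he.ne hml) (commutatorElement_eq_one_iff_mul_comm.1 h₄)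
  left
  push Not at h₂
  obtain ⟨M₁, hM₁, hχA⟩ : ∃ M₁ ≥ M, ∀ m ≥ M₁, χ m ∉ A := by
    by_cases h : ∃ m ≥ M, χ m ∈ A
    · obtain ⟨m, hm, hmA⟩ := h
      exact ⟨m + 1, by omega, fun l hl => h₂ m hm l (by omega) (by omega) hmA⟩
    · push Not at h
      exact ⟨M, le_rfl, h⟩
  refine isEventuallyInner_of_forall_mem hφ he (hA.trans (htail hM₁))
    (fun m hm => (hχ m (hM₁.trans hm)).2) hχA fun z hz => ?_
  obtain ⟨z', hz', -, h⟩ := h₁ z (supported_mono (image_mono (Ici_subset_Ici.2 hM₁)) hz)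
  exact ⟨z', hz', h⟩

end Separation

end FreeGroup

namespace FreeGroup

variable {ι G : Type*} [Group G]

/-- One subgroup of the free group separates `φ` from each of countably many embeddings that are
not eventually inner. -/
theorem exists_subgroup_separates {φ : FreeGroup ι →* G} (hφ : Function.Injective φ)
    {c : ℕ → FreeGroup ι →* G} (hc : ∀ n, Function.Injective (c n)) {e : ℕ → ι} (he : e.Injective)
    {N₀ N₁ : Subgroup (FreeGroup ι)} (hcomm : ∀ x ∈ N₁, ∀ y ∈ N₁, ⁅x, y⁆ ∈ N₀)
    (heN : ∀ m, of (e m) ∈ N₀) {A : Subgroup (FreeGroup ι)} (hA : A ≤ supported (range e)ᶜ) :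
    ∃ L ≥ A, ∀ n, IsEventuallyInner φ (c n) e ∨ Separates φ (c n) N₀ N₁ L := by
  have hstep : ∀ (n : ℕ) (s : {s : ℕ × Subgroup (FreeGroup ι) // s.2 ≤ supported (e '' Ici s.1)ᶜ}),
      ∃ M' ≥ s.1.1, ∃ z ∈ supported (e '' Ici s.1.1), z ∈ supported (e '' Ici M')ᶜ ∧
      (IsEventuallyInner φ (c n) e ∨ ∀ Q ≤ supported (e '' Ici M'),
        Separates φ (c n) N₀ N₁ (s.1.2 ⊔ Subgroup.zpowers z ⊔ Q)) := by
    intro n s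
    rcases exists_separates_or_isEventuallyInner hφ (hc n) he hcomm heN s.2 with
      h | ⟨M', hM', z, hz, hz', h⟩
    · exact ⟨s.1.1, le_rfl, 1, one_mem _, one_mem _, .inl h⟩
    · exact ⟨M', hM', z, hz, hz', .inr h⟩
  choose M' hM' z hz hz' hsep using hstep
  obtain ⟨st, h0, hst⟩ : ∃ st : ℕ → {s : ℕ × Subgroup (FreeGroup ι) //
      s.2 ≤ supported (e '' Ici s.1)ᶜ}, (st 0).1 = (0, A) ∧
      ∀ n, (st (n + 1)).1 = (M' n (st n), (st n).1.2 ⊔ Subgroup.zpowers (z n (st n))) :=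
    ⟨fun n => Nat.rec ⟨(0, A), hA.trans (supported_mono (compl_subset_compl.2
        (image_subset_range _ _)))⟩
      (fun n s => ⟨(M' n s, s.1.2 ⊔ Subgroup.zpowers (z n s)),
        sup_le (s.2.trans (supported_mono (compl_subset_compl.2 (image_mono
          (Ici_subset_Ici.2 (hM' n s)))))) (zpowers_le_supported (hz' n s))⟩) n,
      rfl, fun _ => rfl⟩
  have hmono : Monotone fun n => (st n).1.1 := monotone_nat_of_le_succ fun n => by
    rw [hst n]; exact hM' n _
  have hle : ∀ n, (st n).1.2 ≤ ⨆ n, (st n).1.2 := le_iSup fun n => (st n).1.2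
  refine ⟨⨆ n, (st n).1.2, ?_, fun n => ?_⟩
  · have := hle 0
    rwa [h0] at this
  refine (hsep n (st n)).imp_right fun h => ?_
  let Q : Subgroup (FreeGroup ι) := Subgroup.closure ((fun k => z k (st k)) '' Ioi n)
  have hQ : Q ≤ supported (e '' Ici (M' n (st n))) := by
    refine (Subgroup.closure_le _).2 ?_
    rintro _ ⟨k, hk, rfl⟩
    refine supported_mono (image_mono (Ici_subset_Ici.2 ?_)) (hz k (st k))
    have : (st (n + 1)).1.1 ≤ (st k).1.1 := hmono (Nat.succ_le_of_lt hk)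
    rwa [hst n] at this
  convert h Q hQ using 1
  apply le_antisymm
  · refine iSup_le fun k => ?_
    induction k with
    | zero =>
      refine le_trans ?_ (le_sup_left.trans le_sup_left)
      exact monotone_nat_of_le_succ (f := fun n => (st n).1.2)
        (fun n => by rw [hst n]; exact le_sup_left) (Nat.zero_le n)
    | succ k ih =>
      rw [hst k]
      refine sup_le ih (Subgroup.zpowers_le.2 ?_)
      rcases lt_trichotomy k n with hk | rfl | hk
      · have hmem : z k (st k) ∈ (st (k + 1)).1.2 := by
          rw [hst k]
          exact le_sup_right (a := (st k).1.2) (Subgroup.mem_zpowers _)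
        have hm : (st (k + 1)).1.2 ≤ (st n).1.2 := monotone_nat_of_le_succ
          (f := fun n => (st n).1.2) (fun n => by rw [hst n]; exact le_sup_left)
          (Nat.succ_le_of_lt hk)
        exact (hm.trans (le_sup_left.trans le_sup_left)) hmem
      · exact le_sup_left (a := (st k).1.2 ⊔ _)
          (le_sup_right (a := (st k).1.2) (Subgroup.mem_zpowers _))
      · exact le_sup_right (a := (st n).1.2 ⊔ _) (Subgroup.subset_closure ⟨k, hk, rfl⟩)
  · refine sup_le (sup_le (hle n) ?_) ((Subgroup.closure_le _).2 ?_)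
    · refine le_trans ?_ (hle (n + 1))
      rw [hst n]
      exact le_sup_right
    · rintro _ ⟨k, -, rfl⟩
      refine hle (k + 1) ?_
      rw [hst k]
      exact le_sup_right (a := (st k).1.2) (Subgroup.mem_zpowers _)

/-- If the centralizer of `φ` is determined by finitely many letters of any infinite set, then there
is a subgroup `L` such that conjugacies in `G` between images of subgroups lying between `L ⊓ N₀`
and `L ⊓ N₁` come from conjugacies in the free group. -/
theorem exists_subgroup_forall_conj [Countable ι] {φ : FreeGroup ι →* G}
    (hφ : Function.Injective φ)
    (hfin : ∀ J : Set ι, J.Infinite → ∃ F ⊆ J, F.Finite ∧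
      ∀ g, (∀ j ∈ F, Commute g (φ (of j))) → ∀ j, Commute g (φ (of j)))
    {e : ℕ → ι} (he : e.Injective)
    {N₀ N₁ : Subgroup (FreeGroup ι)} (hcomm : ∀ x ∈ N₁, ∀ y ∈ N₁, ⁅x, y⁆ ∈ N₀)
    (heN : ∀ m, of (e m) ∈ N₀) {J : Set ι} (hJ : J.Infinite) (hJe : J ⊆ (range e)ᶜ)
    (hJN : ∀ j ∈ J, of j ∈ N₀) :
    ∃ L ≥ supported (range e)ᶜ, ∀ Γ Γ' : Subgroup (FreeGroup ι), L ⊓ N₀ ≤ Γ → Γ ≤ L ⊓ N₁ →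
      L ⊓ N₀ ≤ Γ' → Γ' ≤ L ⊓ N₁ → ∀ g : G,
      (Γ.map φ).map (MulAut.conj g).toMonoidHom = Γ'.map φ →
      ∃ b, Γ.map (MulAut.conj b).toMonoidHom = Γ' := by
  have hall : ∀ g, (∀ j, Commute g (φ (of j))) → ∀ f, Commute g (φ f) := by
    intro g hg f
    have : (MulAut.conj g).toMonoidHom.comp φ = φ := by
      ext j
      simp [(hg j).eq]
    have := DFunLike.congr_fun this f
    simpa [Commute, SemiconjBy, mul_inv_eq_iff_eq_mul] using this
  obtain ⟨F, hFJ, hF, hFc⟩ := hfin J hJ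
  have := hF.to_subtype
  have : Countable (F → FreeGroup ι) := inferInstance
  obtain ⟨t, ht⟩ := exists_surjective_nat (F → FreeGroup ι)
  have hg : ∀ n, ∃ g₀ : G, ∀ g, (∀ j : F, g * φ (of j) * g⁻¹ = φ (t n j)) →
      ∀ f, g * φ f * g⁻¹ = g₀ * φ f * g₀⁻¹ := by
    intro n
    by_cases h : ∃ g : G, ∀ j : F, g * φ (of j) * g⁻¹ = φ (t n j)
    · obtain ⟨g₀, hg₀⟩ := h
      refine ⟨g₀, fun g hg f => ?_⟩
      have := hall (g₀⁻¹ * g) (hFc _ fun j hj => ?_) f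
      · have := this.eq
        calc g * φ f * g⁻¹ = g₀ * (g₀⁻¹ * g * φ f) * g⁻¹ := by group
          _ = g₀ * φ f * g₀⁻¹ := by rw [this]; group
      · have := (hg ⟨j, hj⟩).trans (hg₀ ⟨j, hj⟩).symm
        calc g₀⁻¹ * g * φ (of j) = g₀⁻¹ * (g * φ (of j) * g⁻¹) * g := by group
          _ = φ (of j) * (g₀⁻¹ * g) := by rw [this]; group
    · push Not at h
      exact ⟨1, fun g hg => by obtain ⟨j, hj⟩ := h g; exact absurd (hg j) hj⟩
  choose g₀ hg₀ using hg
  obtain ⟨L, hL, hLs⟩ := exists_subgroup_separates hφ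
    (c := fun n => (MulAut.conj (g₀ n)).toMonoidHom.comp φ)
    (fun n => (MulAut.conj (g₀ n)).injective.comp hφ) he hcomm heN le_rfl
  refine ⟨L, hL, fun Γ Γ' h₀ h₁ h₀' h₁' g hΓ => ?_⟩
  have hto : ∀ f ∈ Γ, ∃ f' ∈ Γ', g * φ f * g⁻¹ = φ f' := by
    intro f hf
    have : g * φ f * g⁻¹ ∈ Γ'.map φ := hΓ ▸ ⟨φ f, ⟨f, hf, rfl⟩, rfl⟩
    obtain ⟨f', hf', h⟩ := this
    exact ⟨f', hf', h.symm⟩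
  have hfrom : ∀ f ∈ Γ', ∃ f' ∈ Γ, φ f = g * φ f' * g⁻¹ := by
    intro f hf
    have : φ f ∈ (Γ.map φ).map (MulAut.conj g).toMonoidHom := hΓ ▸ ⟨f, hf, rfl⟩
    obtain ⟨_, ⟨f', hf', rfl⟩, h⟩ := this
    exact ⟨f', hf', h.symm⟩
  have hFt : ∀ j : F, ∃ f', g * φ (of j) * g⁻¹ = φ f' := by
    rintro ⟨j, hj⟩
    obtain ⟨f', -, h⟩ := hto (of j) (h₀ ⟨hL (of_mem_supported (hJe (hFJ hj))), hJN j (hFJ hj)⟩)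
    exact ⟨f', h⟩
  choose t' ht' using hFt
  obtain ⟨n, rfl⟩ := ht t'
  have hgn := hg₀ n g ht'
  rcases hLs n with ⟨b, M, hb⟩ | ⟨f, hf, h⟩ | ⟨f, hf, h⟩
  · refine ⟨b, ?_⟩
    obtain ⟨F', hF', -, hFc'⟩ := hfin (e '' Ici M) ((Ici_infinite M).image he.injOn)
    have hcom := hall ((φ b)⁻¹ * g) (hFc' _ fun j hj => by
      obtain ⟨m, hm, rfl⟩ := hF' hj
      have h₁ : g * φ (of (e m)) * g⁻¹ = φ (b * of (e m) * b⁻¹) := by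
        rw [hgn]; exact hb m hm
      rw [_root_.map_mul, _root_.map_mul, _root_.map_inv] at h₁
      calc (φ b)⁻¹ * g * φ (of (e m)) = (φ b)⁻¹ * (g * φ (of (e m)) * g⁻¹) * g := by group
        _ = φ (of (e m)) * ((φ b)⁻¹ * g) := by rw [h₁]; group)
    have hgb : ∀ f, g * φ f * g⁻¹ = φ (b * f * b⁻¹) := by
      intro f
      rw [_root_.map_mul, _root_.map_mul, _root_.map_inv]
      calc g * φ f * g⁻¹ = φ b * ((φ b)⁻¹ * g * φ f) * g⁻¹ := by group
        _ = φ b * φ f * (φ b)⁻¹ := by rw [(hcom f).eq]; group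
    ext f
    constructor
    · rintro ⟨f, hf, rfl⟩
      obtain ⟨f', hf', h⟩ := hto f hf
      rw [hgb] at h
      have := hφ h
      simpa [this] using hf'
    · intro hf
      obtain ⟨f', hf', h⟩ := hfrom f hf
      rw [hgb] at h
      exact ⟨f', hf', (hφ h).symm⟩
  · obtain ⟨f', hf', h'⟩ := hto f (h₀ hf)
    exact absurd ((hgn f).symm.trans h') (h f' (h₁' hf'))
  · obtain ⟨f', hf', h'⟩ := hfrom f (h₀' hf)
    exact absurd (h'.trans (hgn f')) (h f' (h₁ hf'))

end FreeGroup

namespace LampGroup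

/-- The letters of the free group in which orbits are coded: the letters of the acting group, the
lamps, and two infinite families of idle letters. -/
abbrev Letter := ℕ ⊕ ℕ ⊕ ℕ ⊕ ℕ

/-- The (unrestricted) wreath product of `ℤ^ℕ` by the free group. -/
abbrev Wreath := (FreeGroup ℕ → ℕ → Multiplicative ℤ) ⋊[mulAutArrow] FreeGroup ℕ

/-- The lamp at position `h` with index `i`. -/
def lamp (h : FreeGroup ℕ) (i : ℕ) : FreeGroup ℕ → ℕ → Multiplicative ℤ :=
  Pi.mulSingle h (Pi.mulSingle i (Multiplicative.ofAdd 1))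

theorem mulAutArrow_apply_apply (a : FreeGroup ℕ) (v : FreeGroup ℕ → ℕ → Multiplicative ℤ)
    (h : FreeGroup ℕ) : mulAutArrow a v h = v (a⁻¹ * h) := rfl

theorem mulAutArrow_lamp (a h : FreeGroup ℕ) (i : ℕ) :
    mulAutArrow a (lamp h i) = lamp (a * h) i := by
  ext k j
  rw [mulAutArrow_apply_apply]
  by_cases hk : k = a * h
  · subst hk
    simp [lamp]
  · have : a⁻¹ * k ≠ h := fun h' => hk (by rw [← h']; group)
    simp [lamp, hk, this]

theorem lamp_apply_ne_one_iff {h k : FreeGroup ℕ} {i j : ℕ} : lamp h i k j ≠ 1 ↔ k = h ∧ j = i := by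
  by_cases hk : k = h
  · subst hk
    by_cases hj : j = i
    · subst hj
      simp [lamp]
    · simp [lamp, hj]
  · simp [lamp, hk]

/-- The evaluation of words in the wreath product. -/
def eval : FreeGroup Letter →* Wreath :=
  FreeGroup.lift (Sum.elim (fun n => .inr (.of n)) (Sum.elim (fun i => .inl (lamp 1 i)) 1))

/-- The word spelling an element of the acting group. -/
def spell : FreeGroup ℕ →* FreeGroup Letter := FreeGroup.map Sum.inl

theorem eval_spell (h : FreeGroup ℕ) : eval (spell h) = .inr h := by
  have : eval.comp spell = SemidirectProduct.inr := by
    ext n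
    all_goals simp [eval, spell]
  exact DFunLike.congr_fun this h

theorem eval_of_lamp (i : ℕ) : eval (.of (.inr (.inl i))) = .inl (lamp 1 i) := by
  simp [eval]

theorem eval_of_idle (i : ℕ ⊕ ℕ) : eval (.of (.inr (.inr i))) = 1 := by
  simp [eval]

theorem conj_eval {b : Wreath} {w : FreeGroup ℕ → ℕ → Multiplicative ℤ} :
    b * .inl w * b⁻¹ = .inl (mulAutArrow b.right w) := by
  ext <;> simp

variable {X : Type*} (ρ : FreeGroup ℕ →* Equiv.Perm X) (s : X → ℕ → Bool)

/-- The words whose lamps are lit only at positions allowed by `x`. -/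
def coded (x : X) : Subgroup (FreeGroup Letter) where
  carrier := {f | (eval f).right = 1 ∧ ∀ h i, (eval f).left h i ≠ 1 → s (ρ h⁻¹ x) i = true}
  one_mem' := by simp
  mul_mem' := by
    rintro f f' ⟨h₁, h₂⟩ ⟨h₁', h₂'⟩
    refine ⟨by simp [h₁, h₁'], fun h i hi => ?_⟩
    by_contra hs
    refine hi ?_
    have e₁ : (eval f).left h i = 1 := by_contra fun h' => hs (h₂ h i h')
    have e₂ : (eval f').left h i = 1 := by_contra fun h' => hs (h₂' h i h')
    simp [h₁, e₁, e₂]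
  inv_mem' := by
    rintro f ⟨h₁, h₂⟩
    refine ⟨by simp [h₁], fun h i hi => h₂ h i ?_⟩
    simpa [h₁] using hi

variable {ρ s}

theorem mem_coded_of_eval_eq {x : X} {f : FreeGroup Letter}
    {w : FreeGroup ℕ → ℕ → Multiplicative ℤ} (hf : eval f = .inl w) :
    f ∈ coded ρ s x ↔ ∀ h i, w h i ≠ 1 → s (ρ h⁻¹ x) i = true := by
  change _ ∧ _ ↔ _
  simp [hf]

theorem eval_eq_of_mem_coded {x : X} {f : FreeGroup Letter} (hf : f ∈ coded ρ s x) :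
    eval f = .inl (eval f).left := by
  ext
  · simp
  · simp [hf.1]

theorem mem_coded_iff_of_lamp {x : X} {f : FreeGroup Letter} {h : FreeGroup ℕ} {i : ℕ}
    (hf : eval f = .inl (lamp h i)) : f ∈ coded ρ s x ↔ s (ρ h⁻¹ x) i = true := by
  rw [mem_coded_of_eval_eq hf]
  exact ⟨fun H => H h i (lamp_apply_ne_one_iff.2 ⟨rfl, rfl⟩),
    fun H k j hkj => by obtain ⟨rfl, rfl⟩ := lamp_apply_ne_one_iff.1 hkj; exact H⟩

theorem ker_eval_le_coded (x : X) : eval.ker ≤ coded ρ s x := by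
  intro f hf
  have : eval f = .inl 1 := by rw [MonoidHom.mem_ker.1 hf, map_one]
  rw [mem_coded_of_eval_eq this]
  exact fun _ _ h => absurd rfl h

theorem coded_le_ker (x : X) : coded ρ s x ≤ (SemidirectProduct.rightHom.comp eval).ker :=
  fun _ hf => hf.1

theorem commutator_mem_ker {f f' : FreeGroup Letter}
    (hf : f ∈ (SemidirectProduct.rightHom.comp eval).ker)
    (hf' : f' ∈ (SemidirectProduct.rightHom.comp eval).ker) : ⁅f, f'⁆ ∈ eval.ker := by
  have h : ∀ f ∈ (SemidirectProduct.rightHom.comp eval).ker, eval f = .inl (eval f).left := by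
    intro f hf
    have : (eval f).right = 1 := hf
    ext
    · simp
    · simp [this]
  rw [MonoidHom.mem_ker, map_commutatorElement, h f hf, h f' hf', ← map_commutatorElement,
    commutatorElement_eq_one_iff_mul_comm.2 (mul_comm _ _), map_one]

theorem spell_mul_mul_mem_coded {x : X} {f : FreeGroup Letter} (hf : f ∈ coded ρ s x)
    (a : FreeGroup ℕ) : spell a * f * (spell a)⁻¹ ∈ coded ρ s (ρ a x) := by
  have e : eval (spell a * f * (spell a)⁻¹) = .inl (mulAutArrow a (eval f).left) := by
    rw [map_mul, map_mul, map_inv, eval_spell, eval_eq_of_mem_coded hf, conj_eval]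
    simp
  rw [mem_coded_of_eval_eq e]
  intro h i hi
  have := hf.2 _ i hi
  rwa [smul_eq_mul, mul_inv_rev, inv_inv, map_mul, Equiv.Perm.mul_apply] at this

variable {G : Type*} [Group G]

/-- Orbit equivalence relations of the free group are coded by conjugacy of subgroups. -/
theorem exists_coding (hs : Function.Injective s) {φ : FreeGroup Letter →* G}
    (hφ : Function.Injective φ)
    (hfin : ∀ J : Set Letter, J.Infinite → ∃ F ⊆ J, F.Finite ∧
      ∀ g, (∀ j ∈ F, Commute g (φ (.of j))) → ∀ j, Commute g (φ (.of j))) :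
    ∃ L : Subgroup (FreeGroup Letter), ∀ x y, (∃ a, ρ a x = y) ↔
      ∃ g : G, ((L ⊓ coded ρ s x).map φ).map (MulAut.conj g).toMonoidHom =
        (L ⊓ coded ρ s y).map φ := by
  have hidle : ∀ i, FreeGroup.of (.inr (.inr i)) ∈ eval.ker := eval_of_idle
  obtain ⟨L, hL, hconj⟩ := FreeGroup.exists_subgroup_forall_conj hφ hfin
    (e := fun m => .inr (.inr (.inr m))) (fun m n h => by simpa using h)
    (N₀ := eval.ker) (fun x hx y hy => commutator_mem_ker hx hy) (fun m => hidle _)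
    (J := range fun m => .inr (.inr (.inl m))) (infinite_range_of_injective fun m n h => by
      simpa using h) (by rintro _ ⟨m, rfl⟩ ⟨n, hn⟩; simp at hn)
    (by rintro _ ⟨m, rfl⟩; exact hidle _)
  have hspell : ∀ a, spell a ∈ L := by
    intro a
    refine hL ?_
    induction a using FreeGroup.induction_on with
    | C1 => rw [map_one]; exact one_mem _
    | of n => exact FreeGroup.of_mem_supported (by simp)
    | inv_of n h => rw [map_inv]; exact inv_mem h
    | mul a b ha hb => rw [map_mul]; exact mul_mem ha hb
  have hlamp : ∀ i, FreeGroup.of (.inr (.inl i)) ∈ L := fun i =>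
    hL (FreeGroup.of_mem_supported (by simp))
  have hbetween : ∀ x, L ⊓ eval.ker ≤ L ⊓ coded ρ s x ∧
      L ⊓ coded ρ s x ≤ L ⊓ (SemidirectProduct.rightHom.comp eval).ker := fun x =>
    ⟨inf_le_inf_left _ (ker_eval_le_coded x), inf_le_inf_left _ (coded_le_ker x)⟩
  refine ⟨L, fun x y => ⟨?_, ?_⟩⟩
  · rintro ⟨a, rfl⟩
    refine ⟨φ (spell a), ?_⟩
    ext f
    constructor
    · rintro ⟨_, ⟨f, hf, rfl⟩, rfl⟩
      exact ⟨spell a * f * (spell a)⁻¹, Subgroup.mem_inf.2 ⟨mul_mem (mul_mem (hspell a) hf.1)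
        (inv_mem (hspell a)), spell_mul_mul_mem_coded hf.2 a⟩, by simp⟩
    · rintro ⟨f, hf, rfl⟩
      have := spell_mul_mul_mem_coded hf.2 a⁻¹
      rw [map_inv ρ, ← Equiv.Perm.mul_apply, inv_mul_cancel, Equiv.Perm.one_apply, map_inv,
        inv_inv] at this
      exact ⟨_, ⟨_, Subgroup.mem_inf.2 ⟨mul_mem (mul_mem (inv_mem (hspell a)) hf.1) (hspell a),
        this⟩, rfl⟩, by
        simp [mul_assoc]⟩
  · rintro ⟨g, hg⟩
    obtain ⟨b, hb⟩ := hconj _ _ (hbetween x).1 (hbetween x).2 (hbetween y).1 (hbetween y).2 g hg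
    refine ⟨(eval b).right, ?_⟩
    rw [← Equiv.Perm.eq_inv_iff_eq, ← map_inv]
    refine hs (funext fun i => Bool.eq_iff_iff.2 ⟨fun hi => ?_, fun hi => ?_⟩)
    · have h₁ : FreeGroup.of (.inr (.inl i)) ∈ L ⊓ coded ρ s x :=
        ⟨hlamp i, (mem_coded_iff_of_lamp (eval_of_lamp i)).2 (by simpa using hi)⟩
      have h₂ : b * .of (.inr (.inl i)) * b⁻¹ ∈ L ⊓ coded ρ s y := hb ▸ ⟨_, h₁, rfl⟩
      refine (mem_coded_iff_of_lamp ?_).1 h₂.2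
      rw [map_mul, map_mul, map_inv, eval_of_lamp, conj_eval, mulAutArrow_lamp, mul_one]
    · have e₁ : eval (spell (eval b).right * .of (.inr (.inl i)) * (spell (eval b).right)⁻¹) =
          .inl (lamp (eval b).right i) := by
        rw [map_mul, map_mul, map_inv, eval_of_lamp, eval_spell, conj_eval, mulAutArrow_lamp,
          mul_one, SemidirectProduct.right_inr]
      have h₁ : spell (eval b).right * .of (.inr (.inl i)) * (spell (eval b).right)⁻¹ ∈
          L ⊓ coded ρ s y := Subgroup.mem_inf.2 ⟨mul_mem (mul_mem (hspell _) (hlamp i))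
            (inv_mem (hspell _)), (mem_coded_iff_of_lamp e₁).2 hi⟩
      rw [← hb] at h₁
      obtain ⟨f, hf, hfe⟩ := h₁
      have e₂ : eval f = .inl (lamp 1 i) := by
        have : f = b⁻¹ * (spell (eval b).right * .of (.inr (.inl i)) *
            (spell (eval b).right)⁻¹) * b⁻¹⁻¹ := by
          rw [← hfe]
          simp [mul_assoc]
        rw [this, map_mul, map_mul, e₁, map_inv eval b⁻¹, map_inv eval b, conj_eval,
          mulAutArrow_lamp]
        simp
      simpa using (mem_coded_iff_of_lamp e₂).1 hf.2

end LampGroup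

end

section

open TopologicalSpace Set Topology MeasureTheory

/-- The free group of countably infinite rank embeds into the free group of rank two. -/
theorem FreeGroup.exists_injective_int_fin_two :
    ∃ j : FreeGroup ℤ →* FreeGroup (Fin 2), Function.Injective j := by
  let θ : Multiplicative ℤ →* MulAut (FreeGroup ℤ) :=
    { toFun := fun n => freeGroupCongr (Equiv.addLeft n.toAdd)
      map_one' := by
        ext x
        simp [MulAut.one_apply]
      map_mul' := fun m n => by
        ext x
        rw [MulAut.mul_apply]
        simp only [freeGroupCongr_apply, map.comp]
        congr 2
        ext i
        simp }
  let j : FreeGroup ℤ →* FreeGroup (Fin 2) := lift fun i => of 0 ^ i * of 1 * of 0 ^ (-i)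
  let r : FreeGroup (Fin 2) →* FreeGroup ℤ ⋊[θ] Multiplicative ℤ :=
    lift ![.inr (.ofAdd 1), .inl (of 0)]
  have h : r.comp j = SemidirectProduct.inl := by
    ext1 i
    have h₁ : θ (.ofAdd i) (of 0) = of i := by
      change freeGroupCongr (Equiv.addLeft i) (of 0) = of i
      simp
    have h₂ : (SemidirectProduct.inr (.ofAdd 1) : FreeGroup ℤ ⋊[θ] Multiplicative ℤ) ^ i =
        .inr (.ofAdd i) := by
      rw [← _root_.map_zpow, ← ofAdd_zsmul, smul_eq_mul, mul_one]
    have hr₀ : r (of 0) = .inr (.ofAdd 1) := by simp [r]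
    have hr₁ : r (of 1) = .inl (of 0) := by simp [r]
    rw [MonoidHom.comp_apply]
    simp only [j, lift_apply_of]
    rw [_root_.map_mul, _root_.map_mul, _root_.map_zpow, _root_.map_zpow, hr₀, hr₁, zpow_neg, h₂,
      ← _root_.map_inv, ← SemidirectProduct.inl_aut, h₁]
  refine ⟨j, fun x y hxy => SemidirectProduct.inl_injective (φ := θ) ?_⟩
  rw [← h, MonoidHom.comp_apply, MonoidHom.comp_apply, hxy]

/-- In a finite-dimensional algebra, every sequence has a subsequence along which the centralizer of
any infinite subset is determined by finitely many of its elements. -/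
theorem exists_infinite_forall_commute {A : Type*} [Ring A] [Algebra ℝ A] [FiniteDimensional ℝ A]
    {κ : Type*} [Infinite κ] (x : κ → A) : ∃ I : Set κ, I.Infinite ∧ ∀ J ⊆ I, J.Infinite →
      ∃ F ⊆ J, F.Finite ∧ ∀ g, (∀ j ∈ F, Commute g (x j)) → ∀ j ∈ I, Commute g (x j) := by
  let Z : Set κ → Submodule ℝ A := fun S => (Subalgebra.centralizer ℝ (x '' S)).toSubmodule
  have hZ : ∀ S g, g ∈ Z S ↔ ∀ j ∈ S, Commute g (x j) := by
    intro S g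
    simp only [Z, Subalgebra.mem_toSubmodule, Subalgebra.mem_centralizer_iff, forall_mem_image]
    exact forall₂_congr fun j _ => eq_comm
  have hanti : ∀ S T, S ⊆ T → Z T ≤ Z S := fun S T h g hg =>
    (hZ S g).2 fun j hj => (hZ T g).1 hg j (h hj)
  obtain ⟨_, ⟨I, hI, rfl⟩, hmax⟩ := (wellFounded_gt (α := Submodule ℝ A)).has_min
    (Z '' {I | I.Infinite}) ⟨_, univ, infinite_univ, rfl⟩
  refine ⟨I, hI, fun J hJI hJ => ?_⟩
  obtain ⟨_, ⟨F, ⟨hFJ, hF⟩, rfl⟩, hmin⟩ := (wellFounded_lt (α := Submodule ℝ A)).has_min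
    (Z '' {F | F ⊆ J ∧ F.Finite}) ⟨_, ∅, ⟨empty_subset _, finite_empty⟩, rfl⟩
  refine ⟨F, hFJ, hF, fun g hg => ?_⟩
  have h₁ : Z I = Z J := by
    by_contra hne
    exact hmax _ ⟨J, hJ, rfl⟩ (lt_of_le_of_ne (hanti _ _ hJI) hne)
  rw [← hZ, h₁, hZ]
  intro j hj
  have h₂ : Z (insert j F) = Z F := by
    by_contra hne
    exact hmin _ ⟨_, ⟨insert_subset hj hFJ, hF.insert j⟩, rfl⟩
      (lt_of_le_of_ne (hanti _ _ (subset_insert _ _)) hne)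
  exact (hZ _ g).1 (h₂ ▸ (hZ F g).2 hg) j (mem_insert _ _)

theorem exists_freeGroup_hom {n : ℕ} (G : Subgroup (Matrix (Fin n) (Fin n) ℝ)ˣ)
    (hfree : ∃ F : Subgroup ↥G, DiscreteTopology F ∧ Nonempty (F ≃* FreeGroup (Fin 2)))
    (ι : Type*) [Countable ι] [Infinite ι] :
    ∃ φ : FreeGroup ι →* G, Function.Injective φ ∧ (∃ F : Subgroup ↥G, DiscreteTopology F ∧
      φ.range ≤ F) ∧ ∀ J : Set ι, J.Infinite → ∃ F ⊆ J, F.Finite ∧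
      ∀ g, (∀ j ∈ F, Commute g (φ (.of j))) → ∀ j, Commute g (φ (.of j)) := by
  obtain ⟨F, hF, ⟨e⟩⟩ := hfree
  obtain ⟨j, hj⟩ := FreeGroup.exists_injective_int_fin_two
  let φ₀ : FreeGroup ℤ →* G := F.subtype.comp (e.symm.toMonoidHom.comp j)
  have hφ₀ : Function.Injective φ₀ := F.subtype_injective.comp (e.symm.injective.comp hj)
  obtain ⟨I, hI, hIJ⟩ := exists_infinite_forall_commute
    fun i : ℤ => ((φ₀ (.of i) : (Matrix (Fin n) (Fin n) ℝ)ˣ) : Matrix (Fin n) (Fin n) ℝ)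
  have := hI.to_subtype
  obtain ⟨σ⟩ : Nonempty (ι ≃ I) := nonempty_equiv_of_countable
  have hcomm : ∀ (g : G) i, Commute g (φ₀ (.of i)) ↔
      Commute ((g : (Matrix (Fin n) (Fin n) ℝ)ˣ) : Matrix (Fin n) (Fin n) ℝ)
        ((φ₀ (.of i) : (Matrix (Fin n) (Fin n) ℝ)ˣ) : Matrix (Fin n) (Fin n) ℝ) := by
    intro g i
    simp only [Commute, SemiconjBy, Subtype.ext_iff, Units.ext_iff, Subgroup.coe_mul, Units.val_mul]
  have hσ : Function.Injective fun i => (σ i : ℤ) := Subtype.val_injective.comp σ.injective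
  refine ⟨φ₀.comp (FreeGroup.map fun i => (σ i : ℤ)), hφ₀.comp (FreeGroup.map_injective hσ),
    ⟨F, hF, ?_⟩, fun J hJ => ?_⟩
  · rintro _ ⟨f, rfl⟩
    exact (e.symm (j _)).2
  · obtain ⟨S, hSJ, hS, h⟩ := hIJ ((fun i => (σ i : ℤ)) '' J)
      (by rintro _ ⟨i, -, rfl⟩; exact (σ i).2) (hJ.image hσ.injOn)
    refine ⟨(fun i => (σ i : ℤ)) ⁻¹' S, ?_, hS.preimage hσ.injOn, fun g hg i => ?_⟩
    · intro i hi
      obtain ⟨k, hk, hki⟩ := hSJ hi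
      rwa [← hσ hki]
    · refine (hcomm g _).2 (h _ (fun k hk => ?_) _ (σ i).2)
      obtain ⟨l, hl, rfl⟩ := hSJ hk
      exact (hcomm g _).1 (by simpa using hg l hk)

theorem countableBorelER_borelReducible_conjugacyRel {n : ℕ}
    (G : Subgroup (Matrix (Fin n) (Fin n) ℝ)ˣ)
    (hG : IsClosed (G : Set (Matrix (Fin n) (Fin n) ℝ)ˣ))
    (hfree : ∃ F : Subgroup ↥G, DiscreteTopology F ∧ Nonempty (F ≃* FreeGroup (Fin 2)))
    (C : CountableBorelER.{u}) :
    @BorelReducible _ _ C.inst (torsionFreeDiscreteBorel G) C.rel (conjugacyRel G) := by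
  have : LocallyCompactSpace G := hG.isClosedEmbedding_subtypeVal.locallyCompactSpace
  have : SecondCountableTopology G :=
    hG.isClosedEmbedding_subtypeVal.isEmbedding.secondCountableTopology
  have := C.standardBorel
  obtain ⟨ρ, hρ, hrel⟩ := exists_freeGroup_action C.isEquivalence C.measurableSet_rel
    C.countable_classes
  obtain ⟨s, hs, hsi⟩ :=
    MeasurableSpace.measurable_injection_nat_bool_of_countablySeparated C.carrier
  obtain ⟨φ, hφ, ⟨F, hF, hφF⟩, hfin⟩ := exists_freeGroup_hom G hfree LampGroup.Letter
  obtain ⟨L, hL⟩ := LampGroup.exists_coding (ρ := ρ) hsi hφ hfin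
  let Γ : C.carrier → Subgroup G := fun x => (L ⊓ LampGroup.coded ρ s x).map φ
  have hdisc : ∀ x, DiscreteTopology (Γ x) := by
    intro x
    refine DiscreteTopology.of_subset (s := (F : Set G)) hF ?_
    rintro _ ⟨f, -, rfl⟩
    exact hφF ⟨f, rfl⟩
  have hmem : ∀ f, MeasurableSet {x | f ∈ L ⊓ LampGroup.coded ρ s x} := by
    intro f
    have : {x | f ∈ L ⊓ LampGroup.coded ρ s x} = {x | f ∈ L ∧ (LampGroup.eval f).right = 1} ∩
        ⋂ h, ⋂ i, {x | (LampGroup.eval f).left h i ≠ 1 → s (ρ h⁻¹ x) i = true} := by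
      ext x
      simp only [Set.mem_inter_iff, Set.mem_iInter]
      exact ⟨fun h => ⟨⟨h.1, h.2.1⟩, h.2.2⟩, fun h => ⟨h.1.1, h.1.2, h.2⟩⟩
    rw [this]
    refine (MeasurableSet.const _).inter (.iInter fun h => .iInter fun i => ?_)
    by_cases hne : (LampGroup.eval f).left h i ≠ 1
    · simp only [hne, not_false_eq_true, true_imp_iff, ne_eq]
      exact ((measurable_pi_apply i).comp (hs.comp (hρ h⁻¹))) (measurableSet_singleton true)
    · simp [hne]
  let code : C.carrier → FellSpace G := fun x =>
    (⟨Γ x, by have := hdisc x; exact Subgroup.isClosed_of_discrete⟩ : Closeds G)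
  have hcode : Measurable code := by
    refine FellSpace.measurable_of (fun K _ => ?_) fun U _ => ?_
    · have : code ⁻¹' FellSpace.miss K =
          ⋂ f, ⋂ (_ : φ f ∈ K), {x | f ∈ L ⊓ LampGroup.coded ρ s x}ᶜ := by
        ext x
        simp only [mem_preimage, FellSpace.mem_miss, Set.mem_iInter]
        exact ⟨fun h f hf hx => h _ ⟨f, hx, rfl⟩ hf, by
          rintro h _ ⟨f, hx, rfl⟩ hf; exact h f hf hx⟩
      rw [this]
      exact .iInter fun f => .iInter fun _ => (hmem f).compl
    · have : code ⁻¹' FellSpace.hit U =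
          ⋃ f, ⋃ (_ : φ f ∈ U), {x | f ∈ L ⊓ LampGroup.coded ρ s x} := by
        ext x
        simp only [mem_preimage, FellSpace.mem_hit, Set.mem_iUnion]
        exact ⟨by rintro ⟨_, ⟨f, hx, rfl⟩, hf⟩; exact ⟨f, hf, hx⟩,
          fun ⟨f, hf, hx⟩ => ⟨_, ⟨f, hx, rfl⟩, hf⟩⟩
      rw [this]
      exact .iUnion fun f => .iUnion fun _ => hmem f
  refine ⟨fun x => ⟨code x, Γ x, hdisc x, ?_, rfl⟩, ?_, fun x y => ?_⟩
  · rintro _ ⟨f, -, rfl⟩ hf hfo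
    rw [hφ.isOfFinOrder_iff, isOfFinOrder_iff_eq_one] at hfo
    exact hf (by rw [hfo, map_one])
  · exact measurable_comap_iff.2 hcode
  · rw [hrel, hL]
    refine exists_congr fun g => ?_
    rw [SetLike.ext'_iff, Subgroup.coe_map]
    rfl

end

/-- Let `G` be a closed subgroup of `GL(n, ℝ)` containing a discrete
subgroup isomorphic to the free group on two generators.  Then the conjugacy relation
`E(G, D_tf(G))` on torsion-free discrete subgroups of `G` is essentially countable
universal: (i) it is Borel reducible to some countable Borel equivalence relation on a
standard Borel space, and (ii) every countable Borel equivalence relation on a standard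
Borel space is Borel reducible to it. -/
theorem conjugacy_on_torsionFree_discrete_essentially_countable_universal
    {n : ℕ} (hn : 1 ≤ n)
    (G : Subgroup (Matrix (Fin n) (Fin n) ℝ)ˣ)
    (hGclosed : IsClosed (G : Set (Matrix (Fin n) (Fin n) ℝ)ˣ))
    (hfree : ∃ F : Subgroup ↥G, DiscreteTopology F ∧ Nonempty (F ≃* FreeGroup (Fin 2))) :
    (∃ C : CountableBorelER.{0},
        @BorelReducible _ _ (torsionFreeDiscreteBorel G) C.inst (conjugacyRel G) C.rel) ∧
    (∀ C : CountableBorelER.{u},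
        @BorelReducible _ _ C.inst (torsionFreeDiscreteBorel G) C.rel (conjugacyRel G)) := by
  exact ⟨exists_borelReducible_countableBorelER G hGclosed,
    fun C => countableBorelER_borelReducible_conjugacyRel G hGclosed hfree C⟩
end

section
/- Let G be a countable group acting on a Polish space X such that for each g ∈ G the map x ↦ g·x is Borel measurable. If the quotient topological space X/G (the quotient of X by the orbit equivalence relation, endowed with the quotient topology) is T0, then the orbit equivalence relation is concretely classifiable: there exists a Borel measurable function f : X → ℝ such that for all x, y ∈ X, f(x) = f(y) if and only if x and y lie in the same G-orbit. -/
/-- **a Glimm-type lemma.** Let a countable group `G` act on a Polish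
space `X` so that each map `x ↦ g • x` is Borel measurable.  If the quotient topological
space `X/G` (the quotient by the orbit equivalence relation, with the quotient topology)
is T0, then the orbit equivalence relation is concretely classifiable: there is a Borel
measurable `f : X → ℝ` with `f x = f y` iff `x` and `y` lie in the same `G`-orbit. -/
theorem concretely_classifiable_of_t0_quotient
    {G X : Type*} [Group G] [Countable G] [TopologicalSpace X] [PolishSpace X]
    [MulAction G X]
    (hmeas : ∀ g : G, @Measurable X X (borel X) (borel X) fun x => g • x)
    (hT0 : T0Space (Quotient (MulAction.orbitRel G X))) :
    ∃ f : X → ℝ, @Measurable X ℝ (borel X) _ f ∧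
      ∀ x y : X, f x = f y ↔ ∃ g : G, g • x = y := by
  let _ : MeasurableSpace X := borel X
  have _ : BorelSpace X := ⟨rfl⟩
  have hB := TopologicalSpace.isBasis_countableBasis X
  -- The saturations of basic open sets are Borel and separate orbits.
  let F : X → TopologicalSpace.countableBasis X → Prop := fun x U => ∃ g : G, g • x ∈ U.1
  have hF : Measurable F := by
    refine measurable_pi_iff.2 fun U => measurableSet_setOfPred.1 ?_
    rw [Set.ofPred_exists]
    exact MeasurableSet.iUnion fun g => hmeas g (hB.isOpen U.2).measurableSet
  have hsep : ∀ x y, F x = F y → ∀ V : Set (Quotient (MulAction.orbitRel G X)), IsOpen V →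
      (Quotient.mk _ x ∈ V) → (Quotient.mk _ y ∈ V) := by
    intro x y hxy V hV hx
    obtain ⟨W, hW, hxW, hWV⟩ :=
      hB.exists_subset_of_mem_open hx (hV.preimage continuous_quotient_mk')
    obtain ⟨g, hg⟩ := (congrFun hxy ⟨W, hW⟩).mp ⟨1, by simpa using hxW⟩
    have hgy : Quotient.mk (MulAction.orbitRel G X) (g • y) = Quotient.mk _ y :=
      Quotient.sound (MulAction.mem_orbit y g)
    exact hgy ▸ hWV hg
  refine ⟨fun x => MeasureTheory.embeddingReal (TopologicalSpace.countableBasis X → Prop) (F x),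
    (MeasureTheory.measurableEmbedding_embeddingReal _).measurable.comp hF, fun x y => ?_⟩
  rw [(MeasureTheory.measurableEmbedding_embeddingReal _).injective.eq_iff]
  constructor
  · intro hxy
    have hq : Quotient.mk (MulAction.orbitRel G X) y = Quotient.mk _ x :=
      (inseparable_iff_forall_isOpen.2 fun V hV =>
        ⟨hsep y x hxy.symm V hV, hsep x y hxy V hV⟩).eq
    exact Quotient.exact hq
  · rintro ⟨g, rfl⟩
    funext U
    refine propext ⟨fun ⟨h, hh⟩ => ⟨h * g⁻¹, by simpa [mul_smul] using hh⟩,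
      fun ⟨h, hh⟩ => ⟨h * g, by simpa [mul_smul] using hh⟩⟩
end
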